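/- arXiv:1604.06359 — 4 statements merged into one kernel-verified Lean document; each statement's English description precedes it below -/
import Mathlib

section
/- With p, n, k and the ideal I = I(g_0, g_1, g_2, g_3) as in the context, let R = FreeAlgebra (ZMod (p^n)) (Fin 4) ⧸ I and let u_0, u_1, u_2, u_3 be units of R whose underlying elements are the images of 1 + p X_0, 1 + p X_1, 1 + p X_2, 1 + p X_3 (these are units since (1 + p X_i)^(p^n) = 1). Let Γ = Subgroup.closure {u_0, u_1, u_2, u_3} ≤ Rˣ, S = Subgroup.closure {u_0, u_2} and S' = Subgroup.closure {u_1, u_3}. Then S ⊓ S' = ⊥, and every element g ∈ Γ can be written as g = s * t with s ∈ S and t ∈ S'. -/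
section Group

variable {G : Type*} [Group G]

/-- If `y * x = x * y ^ k`, then powers of `y` and `x` commute up to the exponent of `y`. -/
theorem pow_mul_pow_of_mul_eq_mul_pow {x y : G} {k : ℕ} (h : y * x = x * y ^ k) (m e : ℕ) :
    y ^ m * x ^ e = x ^ e * y ^ (m * k ^ e) := by
  have step (m : ℕ) : y ^ m * x = x * y ^ (m * k) := by
    have : SemiconjBy x (y ^ k) y := h.symm
    rw [mul_comm m k, pow_mul]
    exact (this.pow_right m).eq.symm
  induction e generalizing m with
  | zero => simp
  | succ e ih =>
    rw [pow_succ', ← mul_assoc, step, mul_assoc, ih, ← mul_assoc, ← pow_succ', mul_assoc,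
      ← pow_succ' k e]

/-- If every product `c * b` of elements of `C`, `B` can be rewritten as a product of an element of
`B` and an element of `C`, then the same holds for the subgroups generated by `B` and `C`,
provided that `B` and `C` are stable under inversion. -/
theorem closure_mul_closure_swap {B C : Set G} (hB : ∀ b ∈ B, b⁻¹ ∈ B) (hC : ∀ c ∈ C, c⁻¹ ∈ C)
    (h : ∀ c ∈ C, ∀ b ∈ B, ∃ b' ∈ B, ∃ c' ∈ C, c * b = b' * c')
    {t s : G} (ht : t ∈ Subgroup.closure C) (hs : s ∈ Subgroup.closure B) :
    ∃ s' ∈ Subgroup.closure B, ∃ t' ∈ Subgroup.closure C, t * s = s' * t' := by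
  have key : ∀ s ∈ Subgroup.closure B, ∀ c ∈ C,
      ∃ s' ∈ Subgroup.closure B, ∃ c' ∈ C, c * s = s' * c' := by
    intro s hs
    have step : ∀ b ∈ B, ∀ y, (∀ c ∈ C, ∃ s' ∈ Subgroup.closure B, ∃ c' ∈ C, c * y = s' * c') →
        ∀ c ∈ C, ∃ s' ∈ Subgroup.closure B, ∃ c' ∈ C, c * (b * y) = s' * c' := by
      intro b hb y hy c hc
      obtain ⟨b', hb', c', hc', e⟩ := h c hc b hb
      obtain ⟨s', hs', c'', hc'', e'⟩ := hy c' hc'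
      exact ⟨b' * s', mul_mem (Subgroup.subset_closure hb') hs', c'', hc'', by
        rw [← mul_assoc, e, mul_assoc, e', mul_assoc]⟩
    induction hs using Subgroup.closure_induction_left with
    | one => exact fun c hc => ⟨1, one_mem _, c, hc, by simp⟩
    | mul_left b hb y _ ih => exact step b hb y ih
    | inv_mul_cancel b hb y _ ih => exact step _ (hB b hb) y ih
  have step : ∀ c ∈ C, ∀ y, (∀ s ∈ Subgroup.closure B, ∃ s' ∈ Subgroup.closure B,
      ∃ t' ∈ Subgroup.closure C, y * s = s' * t') → ∀ s ∈ Subgroup.closure B,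
      ∃ s' ∈ Subgroup.closure B, ∃ t' ∈ Subgroup.closure C, (c * y) * s = s' * t' := by
    intro c hc y hy s hs
    obtain ⟨s', hs', t', ht', e⟩ := hy s hs
    obtain ⟨s'', hs'', c', hc', e'⟩ := key s' hs' c hc
    exact ⟨s'', hs'', c' * t', mul_mem (Subgroup.subset_closure hc') ht', by
      rw [mul_assoc, e, ← mul_assoc, e', mul_assoc]⟩
  revert s
  induction ht using Subgroup.closure_induction_left with
  | one => exact fun hs => ⟨_, hs, 1, one_mem _, by simp⟩
  | mul_left c hc y _ ih => exact fun hs => step c hc y (fun s hs => ih hs) _ hs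
  | inv_mul_cancel c hc y _ ih => exact fun hs => step _ (hC c hc) y (fun s hs => ih hs) _ hs

theorem inv_pow_eq_pow_of_pow_eq_one {a : G} {q : ℕ} (h : a ^ q = 1) (hq : q ≠ 0) (m : ℕ) :
    (a ^ m)⁻¹ = a ^ (m * (q - 1)) := by
  rw [inv_eq_iff_mul_eq_one, ← pow_add]
  obtain ⟨r, rfl⟩ := Nat.exists_eq_succ_of_ne_zero hq
  have : m + m * (r.succ - 1) = r.succ * m := by simp; ring
  rw [this, pow_mul, h, one_pow]

theorem closure_powers_pair (a b : G) :
    Subgroup.closure {x | (∃ m : ℕ, x = a ^ m) ∨ ∃ m : ℕ, x = b ^ m} =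
      Subgroup.closure {a, b} := by
  apply le_antisymm
  · rw [Subgroup.closure_le]
    rintro x (⟨m, rfl⟩ | ⟨m, rfl⟩)
    · exact pow_mem (Subgroup.subset_closure (by simp)) m
    · exact pow_mem (Subgroup.subset_closure (by simp)) m
  · apply Subgroup.closure_mono
    rintro x (rfl | rfl)
    · exact Or.inl ⟨1, by simp⟩
    · exact Or.inr ⟨1, by simp⟩

/-- A torsion quotient of a Higman group is the product of the two subgroups generated by opposite
generators. -/
theorem exists_eq_mul_of_higman_relations {a : Fin 4 → G} {q k l : ℕ} (hq : q ≠ 0)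
    (ha : ∀ i, a i ^ q = 1) (hkl : k * l ≡ 1 [MOD q])
    (hrel : ∀ i, a (i + 1) * a i = a i * a (i + 1) ^ k)
    {x : G} (hx : x ∈ Subgroup.closure {a 0, a 1, a 2, a 3}) :
    ∃ s ∈ Subgroup.closure {a 0, a 2}, ∃ t ∈ Subgroup.closure {a 1, a 3}, x = s * t := by
  have swap {t s : G} (ht : t ∈ Subgroup.closure {a 1, a 3})
      (hs : s ∈ Subgroup.closure {a 0, a 2}) :
      ∃ s' ∈ Subgroup.closure {a 0, a 2}, ∃ t' ∈ Subgroup.closure {a 1, a 3},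
        t * s = s' * t' := by
    have hinv (i j : Fin 4) : ∀ b ∈ {x | (∃ m : ℕ, x = a i ^ m) ∨ ∃ m : ℕ, x = a j ^ m},
        b⁻¹ ∈ {x | (∃ m : ℕ, x = a i ^ m) ∨ ∃ m : ℕ, x = a j ^ m} := by
      rintro b (⟨m, rfl⟩ | ⟨m, rfl⟩)
      · exact Or.inl ⟨_, inv_pow_eq_pow_of_pow_eq_one (ha i) hq m⟩
      · exact Or.inr ⟨_, inv_pow_eq_pow_of_pow_eq_one (ha j) hq m⟩
    have h1 (i : Fin 4) (m e : ℕ) : a (i + 1) ^ m * a i ^ e = a i ^ e * a (i + 1) ^ (m * k ^ e) :=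
      pow_mul_pow_of_mul_eq_mul_pow (hrel i) m e
    have h2 (i : Fin 4) (m e : ℕ) : a i ^ e * a (i + 1) ^ m = a (i + 1) ^ (m * l ^ e) * a i ^ e := by
      rw [h1]
      congr 1
      rw [pow_eq_pow_iff_modEq]
      have := ((hkl.pow e).mul_left m).of_dvd (orderOf_dvd_of_pow_eq_one (ha (i + 1)))
      rw [one_pow, mul_one, mul_pow, mul_comm (k ^ e), ← mul_assoc] at this
      exact this.symm
    rw [← closure_powers_pair] at ht hs
    have := closure_mul_closure_swap (hinv 0 2) (hinv 1 3) ?_ ht hs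
    · rwa [closure_powers_pair, closure_powers_pair] at this
    · rintro c (⟨m, rfl⟩ | ⟨m, rfl⟩) b (⟨e, rfl⟩ | ⟨e, rfl⟩)
      · exact ⟨_, Or.inl ⟨_, rfl⟩, _, Or.inl ⟨_, rfl⟩, h1 0 m e⟩
      · exact ⟨_, Or.inr ⟨_, rfl⟩, _, Or.inl ⟨_, rfl⟩, h2 1 e m⟩
      · exact ⟨_, Or.inl ⟨_, rfl⟩, _, Or.inr ⟨_, rfl⟩, h2 3 e m⟩
      · exact ⟨_, Or.inr ⟨_, rfl⟩, _, Or.inr ⟨_, rfl⟩, h1 2 m e⟩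
  induction hx using Subgroup.closure_induction with
  | mem x hx =>
    rcases hx with rfl | rfl | rfl | rfl
    · exact ⟨a 0, Subgroup.subset_closure (by simp), 1, one_mem _, by simp⟩
    · exact ⟨1, one_mem _, a 1, Subgroup.subset_closure (by simp), by simp⟩
    · exact ⟨a 2, Subgroup.subset_closure (by simp), 1, one_mem _, by simp⟩
    · exact ⟨1, one_mem _, a 3, Subgroup.subset_closure (by simp), by simp⟩
  | one => exact ⟨1, one_mem _, 1, one_mem _, by simp⟩
  | mul x y _ _ hx hy =>
    obtain ⟨s, hs, t, ht, rfl⟩ := hx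
    obtain ⟨s', hs', t', ht', rfl⟩ := hy
    obtain ⟨s'', hs'', t'', ht'', e⟩ := swap ht hs'
    exact ⟨s * s'', mul_mem hs hs'', t'' * t', mul_mem ht'' ht', by
      rw [mul_assoc, ← mul_assoc t, e]; simp only [mul_assoc]⟩
  | inv x _ hx =>
    obtain ⟨s, hs, t, ht, rfl⟩ := hx
    rw [mul_inv_rev]
    exact swap (inv_mem ht) (inv_mem hs)

end Group

section Polynomial

open Polynomial

theorem exists_one_add_pow_prime_pow_eq (p N c : ℕ) :
    ∃ F : ℤ[X], (1 + (p : ℤ[X]) * X) ^ (p ^ N * c) = 1 + (p : ℤ[X]) ^ (N + 1) * F := by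
  have h : (p : ℤ[X]) ^ (N + 1) ∣ (1 + (p : ℤ[X]) * X) ^ p ^ N - 1 ^ p ^ N :=
    dvd_sub_pow_of_dvd_sub (by simp) N
  have h2 : (p : ℤ[X]) ^ (N + 1) ∣ ((1 + (p : ℤ[X]) * X) ^ p ^ N) ^ c - 1 := by
    have := sub_dvd_pow_sub_pow ((1 + (p : ℤ[X]) * X) ^ p ^ N) 1 c
    rw [one_pow] at this
    exact dvd_trans (by simpa using h) this
  obtain ⟨Q, hQ⟩ := h2
  exact ⟨Q, by rw [pow_mul, sub_eq_iff_eq_add'.mp hQ]⟩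

/-- `(1 + p t) ^ m ≡ 1 + p t` modulo `p ^ 2` if `m ≡ 1` modulo `p`. -/
theorem exists_one_add_pow_eq {p m : ℕ} (hm : 1 ≤ m) (hp : p ∣ m - 1) :
    ∃ F : ℤ[X], (1 + (p : ℤ[X]) * X) ^ m = 1 + (p : ℤ[X]) * X + (p : ℤ[X]) ^ 2 * F := by
  obtain ⟨r, hr⟩ := hp
  obtain rfl : m = p ^ 1 * r + 1 := by rw [pow_one]; omega
  obtain ⟨Q, hQ⟩ := exists_one_add_pow_prime_pow_eq p 1 r
  refine ⟨Q * (1 + (p : ℤ[X]) * X), ?_⟩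
  rw [pow_succ, hQ]
  ring

end Polynomial

section Stable

variable {R V : Type*} [CommRing R] [AddCommGroup V] [Module R V]

/-- Let `L` be the smallest submodule containing `v` and stable under `A` and `B`. If `D`
kills `v` and satisfies Ore-type commutation relations with `A` and `B`, then `L` is `D`-stable. -/
theorem le_comap_of_commutation {D A B : Module.End R V} {L : Submodule R V} {v : V}
    {r : R} {F E : Polynomial R}
    (hA : D * A = A * D + (1 + r • A) * Polynomial.aeval D F)
    (hB : D * B = B * D + Polynomial.aeval B E * (1 + r • D))
    (hDv : D v = 0) (hv : v ∈ L) (hLA : L ≤ L.comap A) (hLB : L ≤ L.comap B)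
    (hmin : ∀ N : Submodule R V, v ∈ N → N ≤ N.comap A → N ≤ N.comap B → L ≤ N) :
    L ≤ L.comap D := by
  let L' : Submodule R V := ⨅ i : ℕ, L.comap (D ^ i)
  have mem_L' (x : V) : x ∈ L' ↔ ∀ i : ℕ, (D ^ i) x ∈ L := by simp [L']
  have hL'L : L' ≤ L := fun x hx => by simpa using (mem_L' x).1 hx 0
  have hL'D : L' ≤ L'.comap D := fun x hx => by
    rw [Submodule.mem_comap, mem_L']
    intro i
    simpa [pow_succ] using (mem_L' x).1 hx (i + 1)
  have hmax (N : Submodule R V) (hN : N ≤ L) (hND : N ≤ N.comap D) : N ≤ L' := by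
    intro x hx
    rw [mem_L']
    intro i
    apply hN
    induction i with
    | zero => simpa
    | succ i ih => rw [pow_succ']; exact hND ih
  have haeval (N : Submodule R V) (T : Module.End R V) (hN : N ≤ N.comap T)
      (P : Polynomial R) (x : V) (hx : x ∈ N) : Polynomial.aeval T P x ∈ N := by
    have := Polynomial.aeval_apply_smul_mem_of_le_comap (q := N) hx P T hN
    exact this
  have hL : L ≤ L' := by
    apply hmin
    · rw [mem_L']
      intro i
      cases i with
      | zero => simpa
      | succ i => simp [pow_succ, hDv]
    · have : L'.map A ⊔ L' ≤ L' := by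
        apply hmax
        · refine sup_le ?_ hL'L
          rintro _ ⟨x, hx, rfl⟩
          exact hLA (hL'L hx)
        · refine sup_le ?_ (hL'D.trans (Submodule.comap_mono le_sup_right))
          rintro _ ⟨x, hx, rfl⟩
          have e : D (A x) = A (D x + r • Polynomial.aeval D F x) + Polynomial.aeval D F x := by
            have := LinearMap.congr_fun hA x
            simp only [Module.End.mul_apply, LinearMap.add_apply, LinearMap.smul_apply,
              Module.End.one_apply] at this
            rw [this, map_add, map_smul]
            abel
          rw [Submodule.mem_comap, e]
          have hF := haeval L' D hL'D F x hx
          exact add_mem (Submodule.mem_sup_left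
            ⟨_, add_mem (hL'D hx) (L'.smul_mem r hF), rfl⟩) (Submodule.mem_sup_right hF)
      exact fun x hx => this (Submodule.mem_sup_left ⟨x, hx, rfl⟩)
    · let N : Submodule R V := ⨆ i : ℕ, L'.map (B ^ i)
      have hNB : N ≤ N.comap B := by
        refine iSup_le fun i => ?_
        rintro _ ⟨x, hx, rfl⟩
        refine Submodule.mem_iSup_of_mem (i + 1) ⟨x, hx, ?_⟩
        rw [pow_succ', Module.End.mul_apply]
      have hL'N : L' ≤ N := fun x hx => Submodule.mem_iSup_of_mem 0 ⟨x, hx, by simp⟩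
      have hNL : N ≤ L := by
        refine iSup_le fun i => ?_
        rintro _ ⟨x, hx, rfl⟩
        induction i with
        | zero => simpa using hL'L hx
        | succ i ih => rw [pow_succ']; exact hLB ih
      have hND : N ≤ N.comap D := by
        refine iSup_le fun i => ?_
        rintro _ ⟨x, hx, rfl⟩
        rw [Submodule.mem_comap]
        induction i with
        | zero => simpa using hL'N (hL'D hx)
        | succ i ih =>
          have hxN : (B ^ i) x ∈ N := Submodule.mem_iSup_of_mem i ⟨x, hx, rfl⟩
          have := LinearMap.congr_fun hB ((B ^ i) x)
          simp only [Module.End.mul_apply, LinearMap.add_apply, LinearMap.smul_apply,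
            Module.End.one_apply] at this
          rw [pow_succ', Module.End.mul_apply, this]
          exact add_mem (hNB ih) (haeval N B hNB E _ (add_mem hxN (N.smul_mem r ih)))
      exact fun x hx => hmax N hNL hND (hNB (hL'N hx))
  exact fun x hx => hL'L (hL'D (hL hx))

end Stable

section Action

/-- The action of the `j`-th power of a generator `t` on positive words in two letters, where
`t * c = c * t ^ k` for the distinguished letter `c`, `t * b = b ^ l * t` for the other letter `b`,
and `t` fixes the empty word. -/
def wordAction (c : Bool) (k l : ℕ) : ℕ → List Bool → List Bool
  | _, [] => []
  | j, b :: w =>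
    if b = c then b :: wordAction c k l (j * k) w
    else List.replicate (l ^ j) b ++ wordAction c k l j w

variable (c : Bool) (k l : ℕ)

@[simp]
theorem wordAction_nil (j : ℕ) : wordAction c k l j [] = [] := by
  rw [wordAction]

theorem wordAction_cons_self (j : ℕ) (w : List Bool) :
    wordAction c k l j (c :: w) = c :: wordAction c k l (j * k) w := by
  rw [wordAction, if_pos rfl]

theorem wordAction_cons_of_ne {b : Bool} (hb : b ≠ c) (j : ℕ) (w : List Bool) :
    wordAction c k l j (b :: w) = List.replicate (l ^ j) b ++ wordAction c k l j w := by
  rw [wordAction, if_neg hb]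

theorem wordAction_replicate_append {b : Bool} (hb : b ≠ c) (j m : ℕ) (w : List Bool) :
    wordAction c k l j (List.replicate m b ++ w) =
      List.replicate (m * l ^ j) b ++ wordAction c k l j w := by
  induction m with
  | zero => simp
  | succ m ih =>
    rw [List.replicate_succ, List.cons_append, wordAction_cons_of_ne c k l hb, ih,
      ← List.append_assoc, List.replicate_append_replicate]
    congr 2
    ring

theorem wordAction_zero (w : List Bool) : wordAction c k l 0 w = w := by
  induction w with
  | nil => simp
  | cons b w ih =>
    by_cases hb : b = c
    · subst hb
      rw [wordAction_cons_self, zero_mul, ih]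
    · rw [wordAction_cons_of_ne c k l hb, ih]
      simp

theorem wordAction_add (i j : ℕ) (w : List Bool) :
    wordAction c k l (i + j) w = wordAction c k l i (wordAction c k l j w) := by
  induction w generalizing i j with
  | nil => simp
  | cons b w ih =>
    by_cases hb : b = c
    · subst hb
      rw [wordAction_cons_self, wordAction_cons_self, wordAction_cons_self, add_mul, ih]
    · rw [wordAction_cons_of_ne c k l hb, wordAction_cons_of_ne c k l hb,
        wordAction_replicate_append c k l hb, ih, pow_add, mul_comm]

theorem iterate_wordAction (j : ℕ) (w : List Bool) :
    (wordAction c k l 1)^[j] w = wordAction c k l j w := by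
  induction j with
  | zero => rw [wordAction_zero]; rfl
  | succ j ih => rw [Function.iterate_succ_apply', ih, ← wordAction_add, add_comm]

/-- The linear extension of `wordAction` to the free algebra over `ℚ`. -/
noncomputable def wordOperator : Module.End ℤ (MonoidAlgebra ℚ (FreeMonoid Bool)) :=
  MonoidAlgebra.mapDomainLinearMap ℤ ℚ
    (fun w => FreeMonoid.ofList (wordAction c k l 1 w.toList))

theorem wordOperator_pow_single (j : ℕ) (w : FreeMonoid Bool) (q : ℚ) :
    (wordOperator c k l ^ j) (MonoidAlgebra.single w q) =
      MonoidAlgebra.single (FreeMonoid.ofList (wordAction c k l j w.toList)) q := by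
  rw [← iterate_wordAction]
  induction j with
  | zero => simp
  | succ j ih =>
    rw [pow_succ', Module.End.mul_apply, ih, wordOperator,
      MonoidAlgebra.mapDomainLinearMap_single, Function.iterate_succ_apply']
    simp

/-- Left multiplication by a letter. -/
noncomputable def letterOperator (b : Bool) : Module.End ℤ (MonoidAlgebra ℚ (FreeMonoid Bool)) :=
  LinearMap.mulLeft ℤ (MonoidAlgebra.of ℚ _ (FreeMonoid.of b))

theorem letterOperator_single (b : Bool) (w : FreeMonoid Bool) (q : ℚ) :
    letterOperator b (MonoidAlgebra.single w q) =
      MonoidAlgebra.single (FreeMonoid.of b * w) q := by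
  simp [letterOperator, MonoidAlgebra.single_mul_single]

theorem letterOperator_pow_single (b : Bool) (j : ℕ) (w : FreeMonoid Bool) (q : ℚ) :
    (letterOperator b ^ j) (MonoidAlgebra.single w q) =
      MonoidAlgebra.single (FreeMonoid.ofList (List.replicate j b ++ w.toList)) q := by
  induction j with
  | zero => simp
  | succ j ih =>
    rw [pow_succ', Module.End.mul_apply, ih, letterOperator_single]
    rfl

theorem end_ext_single {f g : Module.End ℤ (MonoidAlgebra ℚ (FreeMonoid Bool))}
    (h : ∀ w q, f (MonoidAlgebra.single w q) = g (MonoidAlgebra.single w q)) : f = g := by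
  refine LinearMap.ext fun v => ?_
  induction v using MonoidAlgebra.induction_linear with
  | zero => simp
  | add x y hx hy => rw [map_add, map_add, hx, hy]
  | single w q => exact h w q

theorem wordOperator_mul_letterOperator_self :
    wordOperator c k l * letterOperator c = letterOperator c * wordOperator c k l ^ k := by
  refine end_ext_single fun w q => ?_
  rw [Module.End.mul_apply, Module.End.mul_apply, letterOperator_single, wordOperator_pow_single,
    letterOperator_single, ← pow_one (wordOperator c k l), wordOperator_pow_single]
  have := wordAction_cons_self c k l 1 w.toList
  rw [one_mul] at this
  exact congrArg (fun x => MonoidAlgebra.single (FreeMonoid.ofList x) q) this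

theorem wordOperator_mul_letterOperator_of_ne {b : Bool} (hb : b ≠ c) :
    wordOperator c k l * letterOperator b = letterOperator b ^ l * wordOperator c k l := by
  refine end_ext_single fun w q => ?_
  rw [Module.End.mul_apply, Module.End.mul_apply, letterOperator_single,
    ← pow_one (wordOperator c k l), wordOperator_pow_single, wordOperator_pow_single,
    letterOperator_pow_single]
  have := wordAction_cons_of_ne c k l hb 1 w.toList
  rw [pow_one] at this
  exact congrArg (fun x => MonoidAlgebra.single (FreeMonoid.ofList x) q) this

theorem wordOperator_one : wordOperator c k l 1 = 1 := by
  have := wordOperator_pow_single c k l 1 1 1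
  rwa [pow_one, FreeMonoid.toList_one, wordAction_nil] at this

end Action

section Lattice

/-- The embedding of the free algebra over `ℤ` which maps `1 + p X_b` to the letter `b`. -/
noncomputable def latticeHom (p : ℕ) :
    FreeAlgebra ℤ Bool →ₐ[ℤ] MonoidAlgebra ℚ (FreeMonoid Bool) :=
  FreeAlgebra.lift ℤ fun b =>
    (p : ℚ)⁻¹ • (MonoidAlgebra.of ℚ (FreeMonoid Bool) (FreeMonoid.of b) - 1)

theorem latticeHom_injective {p : ℕ} (hp : p ≠ 0) : Function.Injective (latticeHom p) := by
  have hp' : (p : ℚ) ≠ 0 := by exact_mod_cast hp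
  let θ : MonoidAlgebra ℚ (FreeMonoid Bool) →ₐ[ℚ] MonoidAlgebra ℚ (FreeMonoid Bool) :=
    MonoidAlgebra.lift ℚ _ _ (FreeMonoid.lift fun b =>
      1 + (p : ℚ) • MonoidAlgebra.of ℚ (FreeMonoid Bool) (FreeMonoid.of b))
  let j : FreeAlgebra ℤ Bool →+* MonoidAlgebra ℚ (FreeMonoid Bool) :=
    (MonoidAlgebra.mapRingHom (FreeMonoid Bool) (Int.castRingHom ℚ)).comp
      (FreeAlgebra.equivMonoidAlgebraFreeMonoid (R := ℤ) (X := Bool)).toAlgHom.toRingHom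
  have hj : Function.Injective j :=
    (MonoidAlgebra.map_injective (Int.castRingHom ℚ : ℤ →+ ℚ) Int.cast_injective).comp
      (FreeAlgebra.equivMonoidAlgebraFreeMonoid (R := ℤ) (X := Bool)).injective
  have h : (θ.toRingHom.comp (latticeHom p).toRingHom).toIntAlgHom = j.toIntAlgHom := by
    apply FreeAlgebra.hom_ext
    funext b
    have h1 : θ (MonoidAlgebra.of ℚ (FreeMonoid Bool) (FreeMonoid.of b)) =
        1 + (p : ℚ) • MonoidAlgebra.of ℚ (FreeMonoid Bool) (FreeMonoid.of b) := by
      simp only [θ, MonoidAlgebra.lift_of, FreeMonoid.lift_eval_of]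
    have h2 : j (FreeAlgebra.ι ℤ b) = MonoidAlgebra.of ℚ (FreeMonoid Bool) (FreeMonoid.of b) := by
      simp [j, FreeAlgebra.equivMonoidAlgebraFreeMonoid]
    have h3 : latticeHom p (FreeAlgebra.ι ℤ b) =
        (p : ℚ)⁻¹ • (MonoidAlgebra.of ℚ (FreeMonoid Bool) (FreeMonoid.of b) - 1) := by
      simp only [latticeHom, FreeAlgebra.lift_ι_apply]
    change θ (latticeHom p (FreeAlgebra.ι ℤ b)) = j (FreeAlgebra.ι ℤ b)
    rw [h2, h3, map_smul, map_sub, h1, map_one, add_sub_cancel_left, smul_smul,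
      inv_mul_cancel₀ hp', one_smul]
  intro x y hxy
  apply hj
  have hz (z) : θ (latticeHom p z) = j z := DFunLike.congr_fun h z
  rw [← hz, ← hz, hxy]

/-- Every submodule containing `1` and stable under left multiplication by the generators contains
the range of the embedding. -/
theorem range_latticeHom_le {p : ℕ} {N : Submodule ℤ (MonoidAlgebra ℚ (FreeMonoid Bool))}
    (h1 : 1 ∈ N) (h : ∀ b, ∀ x ∈ N, latticeHom p (FreeAlgebra.ι ℤ b) * x ∈ N) :
    LinearMap.range (latticeHom p).toLinearMap ≤ N := by
  rintro _ ⟨y, rfl⟩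
  suffices H : ∀ x ∈ N, latticeHom p y * x ∈ N by simpa using H 1 h1
  induction y using FreeAlgebra.induction with
  | grade0 r => intro x hx; simpa [AlgHom.commutes, ← zsmul_eq_mul] using N.smul_mem r hx
  | grade1 b => exact h b
  | mul a b ha hb => intro x hx; rw [map_mul, mul_assoc]; exact ha _ (hb _ hx)
  | add a b ha hb => intro x hx; rw [map_add, add_mul]; exact add_mem (ha _ hx) (hb _ hx)

end Lattice

section Descent

open Polynomial

theorem one_add_smul_mul_one_add_smul {E : Type*} [Ring E] (r : ℤ) (A B : E) :
    (1 + r • A) * (1 + r • B) = 1 + r • A + r • B + r ^ 2 • (A * B) := by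
  simp only [mul_add, add_mul, smul_mul_assoc, mul_smul_comm, mul_one, one_mul]
  module

theorem eq_of_smul_sq_left {E : Type*} [Ring E] {r : ℤ} {A D P : E}
    (hr : ∀ {x y : E}, r ^ 2 • x = r ^ 2 • y → x = y)
    (h : (1 + r • D) * (1 + r • A) = (1 + r • A) * (1 + r • D + r ^ 2 • P)) :
    D * A = A * D + (1 + r • A) * P := by
  apply hr
  rw [mul_add _ (1 + r • D), one_add_smul_mul_one_add_smul, one_add_smul_mul_one_add_smul,
    mul_smul_comm, ← sub_eq_zero] at h
  rw [smul_add, ← sub_eq_zero, ← h]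
  abel

theorem eq_of_smul_sq_right {E : Type*} [Ring E] {r : ℤ} {A D P : E}
    (hr : ∀ {x y : E}, r ^ 2 • x = r ^ 2 • y → x = y)
    (h : (1 + r • D) * (1 + r • A) = (1 + r • A + r ^ 2 • P) * (1 + r • D)) :
    D * A = A * D + P * (1 + r • D) := by
  apply hr
  rw [add_mul (1 + r • A), one_add_smul_mul_one_add_smul, one_add_smul_mul_one_add_smul,
    smul_mul_assoc, ← sub_eq_zero] at h
  rw [smul_add, ← sub_eq_zero, ← h]
  abel

theorem exists_one_add_smul_pow_eq {E : Type*} [Ring E] {p m : ℕ} (hm : 1 ≤ m) (hp : p ∣ m - 1) :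
    ∃ F : ℤ[X], ∀ A : E,
      (1 + (p : ℤ) • A) ^ m = 1 + (p : ℤ) • A + (p : ℤ) ^ 2 • aeval A F := by
  obtain ⟨F, hF⟩ := exists_one_add_pow_eq hm hp
  exact ⟨F, fun A => by simpa using congrArg (aeval A) hF⟩

theorem exists_one_add_smul_pow_prime_pow_eq {E : Type*} [Ring E] (p N c : ℕ) :
    ∃ F : ℤ[X], ∀ A : E,
      (1 + (p : ℤ) • A) ^ (p ^ N * c) = 1 + (p : ℤ) ^ (N + 1) • aeval A F := by
  obtain ⟨F, hF⟩ := exists_one_add_pow_prime_pow_eq p N c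
  exact ⟨F, fun A => by simpa using congrArg (aeval A) hF⟩

/-- For each letter `c`, the free algebra on two generators carries an operator `D` killing `1` and
such that `T = 1 + p D` satisfies the Higman relations `T a = a T ^ k` and `T b = b ^ l T`, where
`a = 1 + p X_c` and `b` is `1 + p X` for the other generator. -/
theorem exists_higman_operator {p k l : ℕ} (hp : p ≠ 0) (hk : 1 ≤ k) (hpk : p ∣ k - 1)
    (hl : 1 ≤ l) (hpl : p ∣ l - 1) (c : Bool) :
    ∃ D : Module.End ℤ (FreeAlgebra ℤ Bool), D 1 = 0 ∧
      (1 + (p : ℤ) • D) * (1 + (p : ℤ) • LinearMap.mulLeft ℤ (FreeAlgebra.ι ℤ c)) =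
        (1 + (p : ℤ) • LinearMap.mulLeft ℤ (FreeAlgebra.ι ℤ c)) * (1 + (p : ℤ) • D) ^ k ∧
      (1 + (p : ℤ) • D) * (1 + (p : ℤ) • LinearMap.mulLeft ℤ (FreeAlgebra.ι ℤ (!c))) =
        (1 + (p : ℤ) • LinearMap.mulLeft ℤ (FreeAlgebra.ι ℤ (!c))) ^ l * (1 + (p : ℤ) • D) := by
  have hp' : (p : ℚ) ≠ 0 := by exact_mod_cast hp
  have hcancel (v : MonoidAlgebra ℚ (FreeMonoid Bool)) : (p : ℤ) • (p : ℚ)⁻¹ • v = v := by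
    rw [← Int.cast_smul_eq_zsmul ℚ, smul_smul, Int.cast_natCast, mul_inv_cancel₀ hp', one_smul]
  have hinj {x y : Module.End ℤ (MonoidAlgebra ℚ (FreeMonoid Bool))}
      (h : (p : ℤ) ^ 2 • x = (p : ℤ) ^ 2 • y) : x = y := by
    have hp2 : ((p : ℤ) ^ 2 : ℤ) ≠ 0 := by positivity
    refine LinearMap.ext fun v => ?_
    have := LinearMap.congr_fun h v
    rw [LinearMap.smul_apply, LinearMap.smul_apply, ← Int.cast_smul_eq_zsmul ℚ,
      ← Int.cast_smul_eq_zsmul ℚ] at this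
    exact smul_right_injective _ (Int.cast_ne_zero.mpr hp2) this
  let A (b : Bool) : Module.End ℤ (MonoidAlgebra ℚ (FreeMonoid Bool)) :=
    LinearMap.mulLeft ℤ (latticeHom p (FreeAlgebra.ι ℤ b))
  have hA (b : Bool) : 1 + (p : ℤ) • A b = letterOperator b := by
    refine LinearMap.ext fun v => ?_
    simp only [A, latticeHom, FreeAlgebra.lift_ι_apply, LinearMap.add_apply, LinearMap.smul_apply,
      LinearMap.mulLeft_apply, Module.End.one_apply, smul_mul_assoc, hcancel, letterOperator,
      sub_mul, one_mul]
    abel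
  let D : Module.End ℤ (MonoidAlgebra ℚ (FreeMonoid Bool)) :=
    (p : ℚ)⁻¹ • (wordOperator c k l - 1)
  have hD : 1 + (p : ℤ) • D = wordOperator c k l := by
    refine LinearMap.ext fun v => ?_
    simp only [D, LinearMap.add_apply, LinearMap.smul_apply, hcancel, LinearMap.sub_apply,
      Module.End.one_apply]
    abel
  have hD1 : D 1 = 0 := by simp [D, wordOperator_one]
  obtain ⟨F, hF⟩ := exists_one_add_smul_pow_eq
    (E := Module.End ℤ (MonoidAlgebra ℚ (FreeMonoid Bool))) hk hpk
  obtain ⟨F', hF'⟩ := exists_one_add_smul_pow_eq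
    (E := Module.End ℤ (MonoidAlgebra ℚ (FreeMonoid Bool))) hl hpl
  have hself : (1 + (p : ℤ) • D) * (1 + (p : ℤ) • A c) =
      (1 + (p : ℤ) • A c) * (1 + (p : ℤ) • D) ^ k := by
    rw [hA, hD, wordOperator_mul_letterOperator_self]
  have hother : (1 + (p : ℤ) • D) * (1 + (p : ℤ) • A (!c)) =
      (1 + (p : ℤ) • A (!c)) ^ l * (1 + (p : ℤ) • D) := by
    rw [hA, hD, wordOperator_mul_letterOperator_of_ne]
    simp
  have hDA : D * A c = A c * D + (1 + (p : ℤ) • A c) * aeval D F :=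
    eq_of_smul_sq_left hinj (by rw [← hF]; exact hself)
  have hDB : D * A (!c) = A (!c) * D + aeval (A (!c)) F' * (1 + (p : ℤ) • D) :=
    eq_of_smul_sq_right hinj (by rw [← hF']; exact hother)
  let L := LinearMap.range (latticeHom p).toLinearMap
  have hLA (b : Bool) : L ≤ L.comap (A b) := by
    rintro _ ⟨x, rfl⟩
    exact ⟨FreeAlgebra.ι ℤ b * x, by simp [A]⟩
  have hLD : L ≤ L.comap D := by
    refine le_comap_of_commutation hDA hDB hD1 ⟨1, by simp⟩ (hLA c) (hLA (!c)) ?_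
    intro N h1 hc hc'
    refine range_latticeHom_le h1 fun b x hx => ?_
    rcases Bool.eq_or_eq_not b c with rfl | rfl
    · exact hc hx
    · exact hc' hx
  let e : FreeAlgebra ℤ Bool ≃ₗ[ℤ] L :=
    LinearEquiv.ofInjective (latticeHom p).toLinearMap (latticeHom_injective hp)
  let D' : Module.End ℤ (FreeAlgebra ℤ Bool) :=
    e.symm.toLinearMap ∘ₗ (D.restrict hLD) ∘ₗ e.toLinearMap
  have he (x : FreeAlgebra ℤ Bool) : (e x : MonoidAlgebra ℚ (FreeMonoid Bool)) = latticeHom p x :=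
    rfl
  have hD' (x : FreeAlgebra ℤ Bool) : latticeHom p (D' x) = D (latticeHom p x) := by
    rw [← he, ← he]
    simp [D', LinearMap.restrict_apply]
  have hT' (j : ℕ) (x : FreeAlgebra ℤ Bool) :
      latticeHom p (((1 + (p : ℤ) • D') ^ j) x) = ((1 + (p : ℤ) • D) ^ j) (latticeHom p x) := by
    induction j with
    | zero => simp
    | succ j ih =>
      rw [pow_succ', pow_succ', Module.End.mul_apply, Module.End.mul_apply, ← ih]
      simp only [LinearMap.add_apply, LinearMap.smul_apply, Module.End.one_apply, map_add,
        map_zsmul, hD']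
  have hA' (b : Bool) (j : ℕ) (x : FreeAlgebra ℤ Bool) :
      latticeHom p (((1 + (p : ℤ) • LinearMap.mulLeft ℤ (FreeAlgebra.ι ℤ b)) ^ j) x) =
        ((1 + (p : ℤ) • A b) ^ j) (latticeHom p x) := by
    induction j with
    | zero => simp
    | succ j ih =>
      rw [pow_succ', pow_succ', Module.End.mul_apply, Module.End.mul_apply, ← ih]
      simp only [LinearMap.add_apply, LinearMap.smul_apply, Module.End.one_apply, map_add,
        map_zsmul, LinearMap.mulLeft_apply, map_mul, A]
  refine ⟨D', ?_, ?_, ?_⟩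
  · apply latticeHom_injective hp
    rw [hD', map_one, hD1, map_zero]
  · refine LinearMap.ext fun x => latticeHom_injective hp ?_
    have h1 := hT' 1
    have h2 := hA' c 1
    rw [pow_one, pow_one] at h1 h2
    rw [Module.End.mul_apply, Module.End.mul_apply, h1, h2, h2, hT', ← Module.End.mul_apply,
      ← Module.End.mul_apply, hself]
  · refine LinearMap.ext fun x => latticeHom_injective hp ?_
    have h1 := hT' 1
    have h2 := hA' (!c) 1
    rw [pow_one, pow_one] at h1 h2
    rw [Module.End.mul_apply, Module.End.mul_apply, h1, h2, hA', h1, ← Module.End.mul_apply,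
      ← Module.End.mul_apply, hother]

end Descent

section Representation

theorem exists_mul_modEq_one {p k : ℕ} (hp : p.Prime) (hk : 1 ≤ k) (hpk : p ∣ k - 1) (N : ℕ) :
    ∃ l, 1 ≤ l ∧ p ∣ l - 1 ∧ k * l ≡ 1 [MOD p ^ N] := by
  have hcop : k.Coprime (p ^ N) := by
    refine Nat.Coprime.pow_right _ ((Nat.Prime.coprime_iff_not_dvd hp).2 fun hd => ?_).symm
    have := Nat.dvd_sub hd hpk
    rw [Nat.sub_sub_self hk] at this
    exact hp.one_lt.ne' (Nat.dvd_one.mp this)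
  have hφ : 0 < (p ^ N).totient := Nat.totient_pos.2 (pow_pos hp.pos _)
  refine ⟨k ^ ((p ^ N).totient - 1), Nat.one_le_pow _ _ hk,
    hpk.trans (by simpa using Nat.sub_one_dvd_pow_sub_one k _), ?_⟩
  rw [← pow_succ', Nat.sub_add_cancel hφ]
  exact Nat.ModEq.pow_totient hcop

/-- The free algebra on two letters carries four operators which satisfy the Higman relations up to
`p ^ n`: the even ones are left multiplications by the letters and the odd ones kill `1`. -/
theorem exists_higman_representation {p n k : ℕ} (hp : p.Prime) (hk : 1 ≤ k) (hpk : p ∣ k - 1)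
    {h : Fin 4 → FreeAlgebra ℤ (Fin 4)}
    (hh : ∀ i : Fin 4, ((p : ℤ) ^ 2) • h i =
      (1 + (p : FreeAlgebra ℤ (Fin 4)) * FreeAlgebra.ι ℤ (i + 1)) *
        (1 + (p : FreeAlgebra ℤ (Fin 4)) * FreeAlgebra.ι ℤ i) -
      (1 + (p : FreeAlgebra ℤ (Fin 4)) * FreeAlgebra.ι ℤ i) *
        (1 + (p : FreeAlgebra ℤ (Fin 4)) * FreeAlgebra.ι ℤ (i + 1)) ^ k) :
    ∃ op : Fin 4 → Module.End ℤ (FreeAlgebra ℤ Bool),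
      op 0 = LinearMap.mulLeft ℤ (FreeAlgebra.ι ℤ false) ∧
      op 2 = LinearMap.mulLeft ℤ (FreeAlgebra.ι ℤ true) ∧ op 1 1 = 0 ∧ op 3 1 = 0 ∧
      ∀ i, ∃ C, FreeAlgebra.lift ℤ op (h i) = (p : ℤ) ^ n • C := by
  obtain ⟨l, hl1, hpl, hkl⟩ := exists_mul_modEq_one hp hk hpk (n + 1)
  obtain ⟨c, hc⟩ := (Nat.modEq_iff_dvd' (Nat.one_le_iff_ne_zero.2 (by positivity))).1 hkl.symm
  have hc' : k * l = p ^ (n + 1) * c + 1 := by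
    have : 1 ≤ k * l := Nat.one_le_iff_ne_zero.2 (by positivity)
    omega
  obtain ⟨D, hD, hD1, hD2⟩ := exists_higman_operator hp.ne_zero hk hpk hl1 hpl false
  obtain ⟨D', hD', hD1', hD2'⟩ := exists_higman_operator hp.ne_zero hk hpk hl1 hpl true
  let op : Fin 4 → Module.End ℤ (FreeAlgebra ℤ Bool) :=
    ![LinearMap.mulLeft ℤ (FreeAlgebra.ι ℤ false), D,
      LinearMap.mulLeft ℤ (FreeAlgebra.ι ℤ true), D']
  have hp2 : ((p : ℤ) ^ 2 : ℤ) ≠ 0 := pow_ne_zero _ (by exact_mod_cast hp.ne_zero)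
  have hcancel {x y : Module.End ℤ (FreeAlgebra ℤ Bool)}
      (h : (p : ℤ) ^ 2 • x = (p : ℤ) ^ 2 • y) : x = y :=
    LinearMap.ext fun v => smul_right_injective _ hp2 (LinearMap.congr_fun h v)
  have hop (i : Fin 4) : (p : ℤ) ^ 2 • FreeAlgebra.lift ℤ op (h i) =
      (1 + (p : ℤ) • op (i + 1)) * (1 + (p : ℤ) • op i) -
        (1 + (p : ℤ) • op i) * (1 + (p : ℤ) • op (i + 1)) ^ k := by
    rw [← map_smul, hh]
    simp [zsmul_eq_mul]
  obtain ⟨F, hF⟩ := exists_one_add_smul_pow_prime_pow_eq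
    (E := Module.End ℤ (FreeAlgebra ℤ Bool)) p (n + 1) c
  have key (A T : Module.End ℤ (FreeAlgebra ℤ Bool))
      (hT : T * (1 + (p : ℤ) • A) = (1 + (p : ℤ) • A) ^ l * T) :
      ∃ C, (1 + (p : ℤ) • A) * T - T * (1 + (p : ℤ) • A) ^ k = (p : ℤ) ^ 2 • (p : ℤ) ^ n • C := by
    have hTk (j : ℕ) : T * (1 + (p : ℤ) • A) ^ j = (1 + (p : ℤ) • A) ^ (l * j) * T := by
      rw [pow_mul]
      exact (SemiconjBy.pow_right hT j :)
    refine ⟨-(Polynomial.aeval A F * (1 + (p : ℤ) • A) * T), ?_⟩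
    rw [hTk, mul_comm l, hc', pow_succ, hF, show n + 1 + 1 = 2 + n by omega, pow_add, mul_smul]
    generalize 1 + (p : ℤ) • A = a
    rw [add_mul, one_mul, smul_mul_assoc, smul_mul_assoc, add_mul, smul_mul_assoc, smul_mul_assoc,
      smul_neg, smul_neg, sub_add_cancel_left]
  refine ⟨op, rfl, rfl, hD, hD', fun i => ?_⟩
  fin_cases i
  · refine ⟨0, hcancel ?_⟩
    rw [hop, smul_zero, smul_zero, sub_eq_zero]
    exact hD1
  · obtain ⟨C, hC⟩ := key _ _ hD2
    exact ⟨C, hcancel ((hop 1).trans hC)⟩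
  · refine ⟨0, hcancel ?_⟩
    rw [hop, smul_zero, smul_zero, sub_eq_zero]
    exact hD1'
  · obtain ⟨C, hC⟩ := key _ _ hD2'
    exact ⟨C, hcancel ((hop 3).trans hC)⟩

end Representation

/-- A subgroup generated by a set of units of finite order lies in every submonoid of the ring
containing the generators. -/
theorem val_mem_of_mem_closure {R : Type*} [Monoid R] {s : Set Rˣ} {q : ℕ} (hq : q ≠ 0)
    (hs : ∀ x ∈ s, x ^ q = 1) {P : Submonoid R} (hP : ∀ x ∈ s, (x : R) ∈ P) {x : Rˣ}
    (hx : x ∈ Subgroup.closure s) : (x : R) ∈ P := by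
  rw [← Subgroup.mem_toSubmonoid, Subgroup.closure_toSubmonoid_of_isOfFinOrder fun x hx =>
    isOfFinOrder_iff_pow_eq_one.2 ⟨q, Nat.pos_of_ne_zero hq, hs x hx⟩] at hx
  exact (Submonoid.closure_le (S := P.comap (Units.coeHom R))).2 hP hx

theorem eq_of_one_tmul_eq_one_tmul {q : ℕ} {A M : Type*} [AddCommGroup A] [AddCommGroup M]
    [Module (ZMod q) M] (f : A →+ M) {x y : A}
    (h : TensorProduct.tmul ℤ (1 : ZMod q) x = TensorProduct.tmul ℤ 1 y) : f x = f y := by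
  simpa using congrArg (LinearMap.liftBaseChange (ZMod q) f.toIntLinearMap) h

/-- With `I = I(g_0, g_1, g_2, g_3)` as in the Higman-algebra context,
let `R` be the quotient algebra and `u i` units of `R` whose underlying elements are the images of
`1 + p X_i`. Let `Γ = ⟨u_0, u_1, u_2, u_3⟩`, `S = ⟨u_0, u_2⟩` and `S' = ⟨u_1, u_3⟩`. Then
`S ⊓ S' = ⊥` and every `γ ∈ Γ` can be written as `γ = s * t` with `s ∈ S`, `t ∈ S'`. -/
theorem higman_units_zappa_szep
    (p n k : ℕ) (hp : Nat.Prime p) (hn : 1 ≤ n) (hk : 2 ≤ k) (hdvd : p ∣ k - 1)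
    (h : Fin 4 → FreeAlgebra ℤ (Fin 4))
    (hh : ∀ i : Fin 4, ((p : ℤ) ^ 2) • h i =
      (1 + (p : FreeAlgebra ℤ (Fin 4)) * FreeAlgebra.ι ℤ (i + 1)) *
        (1 + (p : FreeAlgebra ℤ (Fin 4)) * FreeAlgebra.ι ℤ i) -
      (1 + (p : FreeAlgebra ℤ (Fin 4)) * FreeAlgebra.ι ℤ i) *
        (1 + (p : FreeAlgebra ℤ (Fin 4)) * FreeAlgebra.ι ℤ (i + 1)) ^ k)
    (g : Fin 4 → FreeAlgebra (ZMod (p ^ n)) (Fin 4))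
    (hg : ∀ i, g i = FreeAlgebra.lift ℤ (fun j => FreeAlgebra.ι (ZMod (p ^ n)) j) (h i))
    (u : Fin 4 → ((TwoSidedIdeal.span {g 0, g 1, g 2, g 3}).ringCon.Quotient)ˣ)
    (hu : ∀ i, (u i : (TwoSidedIdeal.span {g 0, g 1, g 2, g 3}).ringCon.Quotient) =
      RingCon.mk' (TwoSidedIdeal.span {g 0, g 1, g 2, g 3}).ringCon
        (1 + (p : FreeAlgebra (ZMod (p ^ n)) (Fin 4)) * FreeAlgebra.ι (ZMod (p ^ n)) i)) :
    Subgroup.closure {u 0, u 2} ⊓ Subgroup.closure {u 1, u 3} = ⊥ ∧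
    ∀ γ ∈ Subgroup.closure {u 0, u 1, u 2, u 3},
      ∃ s ∈ Subgroup.closure {u 0, u 2}, ∃ t ∈ Subgroup.closure {u 1, u 3}, γ = s * t := by
  revert u
  generalize hI : (TwoSidedIdeal.span {g 0, g 1, g 2, g 3}).ringCon = I
  intro u hu
  have hq : p ^ n ≠ 0 := pow_ne_zero _ hp.ne_zero
  have hk1 : 1 ≤ k := by omega
  have hgI (i : Fin 4) : I.mk' (g i) = 0 := by
    refine (RingCon.eq I).2 ?_
    rw [← hI]
    have : g i ∈ TwoSidedIdeal.span {g 0, g 1, g 2, g 3} := by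
      refine TwoSidedIdeal.subset_span ?_
      fin_cases i <;> simp
    exact this
  have hq0 : ((p : I.Quotient) ^ n) = 0 := by
    have : ((p ^ n : ℕ) : FreeAlgebra (ZMod (p ^ n)) (Fin 4)) = 0 := by
      rw [← map_natCast (algebraMap (ZMod (p ^ n)) _), ZMod.natCast_self, map_zero]
    have := congrArg I.mk' this
    rwa [map_natCast, map_zero, Nat.cast_pow] at this
  have hu' (i : Fin 4) : (u i : I.Quotient) =
      1 + (p : I.Quotient) * I.mk' (FreeAlgebra.ι (ZMod (p ^ n)) i) := by
    rw [hu, map_add, map_mul, map_natCast, map_one]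
  have hupow (i : Fin 4) : u i ^ p ^ n = 1 := by
    obtain ⟨F, hF⟩ := exists_one_add_smul_pow_prime_pow_eq (E := I.Quotient) p n 1
    have := hF (I.mk' (FreeAlgebra.ι (ZMod (p ^ n)) i))
    rw [mul_one, zsmul_eq_mul, zsmul_eq_mul, Int.cast_pow, Int.cast_natCast, pow_succ, hq0,
      zero_mul, zero_mul, add_zero, ← hu'] at this
    exact Units.ext (by simpa using this)
  let π : FreeAlgebra ℤ (Fin 4) →ₐ[ℤ] FreeAlgebra (ZMod (p ^ n)) (Fin 4) :=
    FreeAlgebra.lift ℤ (fun j => FreeAlgebra.ι (ZMod (p ^ n)) j)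
  have hπ (i) : π (FreeAlgebra.ι ℤ i) = FreeAlgebra.ι (ZMod (p ^ n)) i :=
    FreeAlgebra.lift_ι_apply _ _
  have hrel (i : Fin 4) : u (i + 1) * u i = u i * u (i + 1) ^ k := by
    have := congrArg (fun x => I.mk' (π x)) (hh i)
    simp only [map_zsmul, map_sub, map_mul, map_add, map_one, map_natCast, map_pow,
      hπ, ← hu'] at this
    have hgi : I.mk' (π (h i)) = 0 := by rw [← hgI i, hg]
    rw [hgi, smul_zero, eq_comm, sub_eq_zero] at this
    exact Units.ext (by simpa using this)
  refine ⟨?_, ?_⟩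
  · rw [eq_bot_iff]
    rintro x ⟨hx, hx'⟩
    obtain ⟨op, hop0, hop2, hop1, hop3, hop⟩ := exists_higman_representation (n := n) hp hk1 hdvd hh
    let B := Module.End.baseChangeHom ℤ (ZMod (p ^ n)) (FreeAlgebra ℤ Bool)
    have hB (f : Module.End ℤ (FreeAlgebra ℤ Bool)) (y) :
        B f (TensorProduct.tmul ℤ 1 y) = TensorProduct.tmul ℤ 1 (f y) := rfl
    let Φ : FreeAlgebra (ZMod (p ^ n)) (Fin 4) →ₐ[ZMod (p ^ n)]
        Module.End (ZMod (p ^ n)) (TensorProduct ℤ (ZMod (p ^ n)) (FreeAlgebra ℤ Bool)) :=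
      FreeAlgebra.lift (ZMod (p ^ n)) fun i => B (op i)
    have hΦ (x) : Φ (π x) = B (FreeAlgebra.lift ℤ op x) := by
      have : ((Φ.restrictScalars ℤ).comp π) = B.comp (FreeAlgebra.lift ℤ op) := by
        apply FreeAlgebra.hom_ext
        funext i
        simp [hπ, Φ]
      exact DFunLike.congr_fun this x
    have hΦg (i : Fin 4) : Φ (g i) = 0 := by
      obtain ⟨C, hC⟩ := hop i
      rw [hg]
      change Φ (π (h i)) = 0
      rw [hΦ, hC, map_smul]
      refine LinearMap.ext fun v => ?_
      rw [LinearMap.smul_apply, ← Int.cast_smul_eq_zsmul (ZMod (p ^ n)), Int.cast_pow,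
        Int.cast_natCast, ← Nat.cast_pow, ZMod.natCast_self, zero_smul, LinearMap.zero_apply]
    have hker : I ≤ RingCon.ker Φ.toRingHom := by
      have : TwoSidedIdeal.span {g 0, g 1, g 2, g 3} ≤ TwoSidedIdeal.ker Φ.toRingHom := by
        refine TwoSidedIdeal.span_le.2 ?_
        have h0 (i : Fin 4) : g i ∈ TwoSidedIdeal.ker Φ.toRingHom :=
          (TwoSidedIdeal.mem_ker _).2 (hΦg i)
        rintro _ (rfl | rfl | rfl | rfl) <;> exact h0 _
      rw [← hI]
      exact TwoSidedIdeal.ringCon_le_iff.1 this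
    let Ψ := I.lift Φ.toRingHom hker
    have hΨ (x) : Ψ (I.mk' x) = Φ x := rfl
    have hΨu (i) : Ψ (u i) = 1 + (p : Module.End (ZMod (p ^ n)) _) * B (op i) := by
      rw [hu, hΨ, map_add, map_mul, map_natCast, map_one, FreeAlgebra.lift_ι_apply]
    let v : TensorProduct ℤ (ZMod (p ^ n)) (FreeAlgebra ℤ Bool) :=
      TensorProduct.tmul ℤ 1 1
    have hfix : Ψ x v = v := by
      let P : Submonoid I.Quotient :=
        { carrier := {r | Ψ r v = v}
          one_mem' := by simp
          mul_mem' := fun {r s} (hr : Ψ r v = v) (hs : Ψ s v = v) => by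
            change Ψ (r * s) v = v
            rw [map_mul, Module.End.mul_apply, hs, hr] }
      have hP (i) (hi : op i 1 = 0) : (u i : I.Quotient) ∈ P := by
        have : B (op i) v = 0 := by rw [hB, hi, TensorProduct.tmul_zero]
        change Ψ (u i) v = v
        rw [hΨu, LinearMap.add_apply, Module.End.mul_apply, this, map_zero, add_zero,
          Module.End.one_apply]
      refine val_mem_of_mem_closure (P := P) hq ?_ ?_ hx'
      · rintro _ (rfl | rfl) <;> exact hupow _
      · rintro _ (rfl | rfl)
        exacts [hP 1 hop1, hP 3 hop3]
    let η : FreeAlgebra ℤ Bool →ₐ[ℤ] I.Quotient := FreeAlgebra.lift ℤ fun b =>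
      I.mk' (FreeAlgebra.ι (ZMod (p ^ n)) (if b then 2 else 0))
    have hη (y) : Ψ (η y) = B (LinearMap.mulLeft ℤ y) := by
      have : Ψ.toIntAlgHom.comp η = B.comp (Algebra.lmul ℤ (FreeAlgebra ℤ Bool)) := by
        apply FreeAlgebra.hom_ext
        funext b
        change Ψ (η (FreeAlgebra.ι ℤ b)) = B (LinearMap.mulLeft ℤ (FreeAlgebra.ι ℤ b))
        rw [FreeAlgebra.lift_ι_apply, hΨ, FreeAlgebra.lift_ι_apply]
        cases b
        · exact congrArg B hop0
        · exact congrArg B hop2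
      exact DFunLike.congr_fun this y
    have hxη : (x : I.Quotient) ∈ η.range.toSubmonoid := by
      refine val_mem_of_mem_closure hq ?_ ?_ hx
      · rintro _ (rfl | rfl) <;> exact hupow _
      · have h0 (b : Bool) : (u (if b then 2 else 0) : I.Quotient) ∈ η.range := by
          refine ⟨1 + (p : FreeAlgebra ℤ Bool) * FreeAlgebra.ι ℤ b, ?_⟩
          simp [η, hu']
        rintro _ (rfl | rfl)
        exacts [h0 false, h0 true]
    obtain ⟨y, hy : η y = x⟩ := hxη
    rw [← hy, hη, hB, LinearMap.mulLeft_apply, mul_one] at hfix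
    have := eq_of_one_tmul_eq_one_tmul (η : FreeAlgebra ℤ Bool →+ I.Quotient) hfix
    refine Subgroup.mem_bot.2 (Units.ext ?_)
    simpa [hy] using this
  · intro γ hγ
    obtain ⟨l, -, -, hl⟩ := exists_mul_modEq_one hp hk1 hdvd n
    exact exists_eq_mul_of_higman_relations hq hupow hl hrel hγ
end

section
/- With p, n, k and the two-variable relator g_0 as in the context, the images modulo the two-sided ideal I(g_0) of the monomials X_1^i * X_0^j, for (i, j) ∈ ℕ × ℕ, form a basis of the quotient FreeAlgebra (ZMod (p^n)) (Fin 2) ⧸ I(g_0) as a ZMod (p^n)-module. -/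
open Polynomial in
/-- The operator `g ↦ v * (g(u) - g(X)) / (u - X)`, characterised without division. -/
theorem exists_linearMap_apply_X_mul {R : Type*} [CommRing R] (u v : R[X]) :
    ∃ D : R[X] →ₗ[R] R[X], D 1 = 0 ∧ ∀ g, D (X * g) = X * D g + v * aeval u g := by
  let d : ℕ → R[X] := fun i => Nat.rec 0 (fun i e => X * e + v * u ^ i) i
  have hD (i : ℕ) : (basisMonomials R).constr R d (X ^ i) = d i := by
    rw [← (basisMonomials R).constr_basis R d i, coe_basisMonomials, ← monomial_one_right_eq_X_pow]
  refine ⟨(basisMonomials R).constr R d, by simpa [d] using hD 0, fun g => ?_⟩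
  induction g using Polynomial.induction_on' with
  | add p q hp hq => simp only [mul_add, map_add, hp, hq]; ring
  | monomial i r =>
    rw [← C_mul_X_pow_eq_monomial, ← smul_eq_C_mul, mul_smul_comm, ← pow_succ']
    simp only [map_smul, hD, map_pow, aeval_X, mul_smul_comm, ← smul_add]
    rfl

open Polynomial in
/-- A substitution congruent to the identity modulo a nilpotent constant is invertible. -/
theorem bijective_aeval_X_add_C_mul {R : Type*} [CommRing R] {c : R} (hc : IsNilpotent c)
    (v : R[X]) : Function.Bijective (aeval (R := R) (X + C c * v)) := by
  let N : Module.End R R[X] := (aeval (R := R) (X + C c * v)).toLinearMap - 1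
  have hN (f : R[X]) : ∃ g, N f = c • g := by
    have h := sub_dvd_eval_sub (X + C c * v) X (f.map C)
    rw [add_sub_cancel_left, eval_map, eval_map, ← algebraMap_eq, ← aeval_def, ← aeval_def,
      aeval_X_left_apply] at h
    obtain ⟨g, hg⟩ := h
    exact ⟨v * g, by simpa [N, smul_eq_C_mul, mul_assoc] using hg⟩
  have hpow (i : ℕ) (f : R[X]) : ∃ g, (N ^ i) f = c ^ i • g := by
    induction i with
    | zero => exact ⟨f, by simp⟩
    | succ i ih =>
      obtain ⟨g, hg⟩ := ih
      obtain ⟨g', hg'⟩ := hN g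
      exact ⟨g', by rw [pow_succ', Module.End.mul_apply, hg, map_smul, hg', smul_smul, pow_succ]⟩
  obtain ⟨n, hn⟩ := hc
  have hNil : IsNilpotent N := by
    refine ⟨n, LinearMap.ext fun f => ?_⟩
    obtain ⟨g, hg⟩ := hpow n f
    rw [hg, hn, zero_smul, LinearMap.zero_apply]
  have hunit := hNil.isUnit_one_add
  rw [add_sub_cancel, Module.End.isUnit_iff] at hunit
  exact hunit

open Polynomial in
theorem mul_aeval_aeval_eq {R Q : Type*} [CommRing R] [Ring Q] [Algebra R Q] {u v : R[X]}
    {D : R[X] →ₗ[R] R[X]} (hD₁ : D 1 = 0) (hD : ∀ g, D (X * g) = X * D g + v * aeval u g)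
    {a b : Q} (hab : b * a = a * aeval b u + aeval b v) (g : R[X]) :
    a * aeval b (aeval u g) = aeval b g * a - aeval b (D g) := by
  induction g using Polynomial.induction_on' with
  | add p q hp hq => simp only [map_add, mul_add, add_mul, hp, hq]; abel
  | monomial i r =>
    rw [← C_mul_X_pow_eq_monomial, ← smul_eq_C_mul]
    simp only [map_smul, mul_smul_comm, smul_mul_assoc, ← smul_sub]
    congr 1
    induction i with
    | zero => simp [hD₁]
    | succ i ih =>
      rw [pow_succ', hD, map_mul, map_mul, map_mul, map_add, map_mul, map_mul, aeval_X, aeval_X,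
        ← mul_assoc, eq_sub_of_add_eq hab.symm, sub_mul, mul_assoc b a, ih]
      noncomm_ring

open Polynomial in
/-- Every word in `a` and `b` is a combination of ordered monomials `b ^ i * a ^ j`. -/
theorem lift_mem_span_pow_mul_pow {R Q : Type*} [CommRing R] [Ring Q] [Algebra R Q] {u v : R[X]}
    (hu : Function.Surjective (aeval (R := R) u))
    {a b : Q} (hab : b * a = a * aeval b u + aeval b v) (x : FreeAlgebra R (Fin 2)) :
    FreeAlgebra.lift R ![a, b] x ∈
      Submodule.span R (Set.range fun ij : ℕ × ℕ => b ^ ij.1 * a ^ ij.2) := by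
  set N := Submodule.span R (Set.range fun ij : ℕ × ℕ => b ^ ij.1 * a ^ ij.2) with hNdef
  have hmon (i j : ℕ) : b ^ i * a ^ j ∈ N := Submodule.subset_span ⟨(i, j), rfl⟩
  have haeval (f : R[X]) (j : ℕ) : aeval b f * a ^ j ∈ N := by
    rw [aeval_eq_sum_range, Finset.sum_mul]
    exact N.sum_mem fun i _ => by rw [smul_mul_assoc]; exact N.smul_mem _ (hmon i j)
  obtain ⟨D, hD₁, hD⟩ := exists_linearMap_apply_X_mul u v
  have hb (y : Q) (hy : y ∈ N) : b * y ∈ N := by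
    suffices N ≤ N.comap (LinearMap.mulLeft R b) from this hy
    refine Submodule.span_le.2 ?_
    rintro _ ⟨⟨i, j⟩, rfl⟩
    simpa [← mul_assoc, ← pow_succ'] using hmon (i + 1) j
  have ha (y : Q) (hy : y ∈ N) : a * y ∈ N := by
    suffices N ≤ N.comap (LinearMap.mulLeft R a) from this hy
    refine Submodule.span_le.2 ?_
    rintro _ ⟨⟨i, j⟩, rfl⟩
    obtain ⟨g, hg⟩ := hu (X ^ i)
    have h := mul_aeval_aeval_eq hD₁ hD hab g
    rw [hg, map_pow, aeval_X] at h
    change a * (b ^ i * a ^ j) ∈ N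
    rw [← mul_assoc, h, sub_mul, mul_assoc, ← pow_succ']
    exact N.sub_mem (haeval _ _) (haeval _ _)
  have hmul (y : Q) (hy : y ∈ N) : FreeAlgebra.lift R ![a, b] x * y ∈ N := by
    induction x using FreeAlgebra.induction generalizing y with
    | grade0 r => simpa [← Algebra.smul_def] using N.smul_mem r hy
    | grade1 i => fin_cases i <;> simp [ha y hy, hb y hy]
    | mul p q hp hq => rw [map_mul, mul_assoc]; exact hp _ (hq _ hy)
    | add p q hp hq => rw [map_add, add_mul]; exact N.add_mem (hp _ hy) (hq _ hy)
  simpa using hmul 1 (by simpa using hmon 0 0)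

open Polynomial in
theorem exists_end_linearIndependent_pow_mul_pow {R : Type*} [CommRing R] {u : R[X]} (v : R[X])
    (hu : Function.Bijective (aeval (R := R) u)) :
    ∃ (A B : Module.End R (ℕ →₀ R[X])) (m : ℕ →₀ R[X]),
      B * A = A * aeval B u + aeval B v ∧
        LinearIndependent R fun ij : ℕ × ℕ => (B ^ ij.1 * A ^ ij.2) m := by
  let σ : R[X] ≃ₐ[R] R[X] := AlgEquiv.ofBijective _ hu
  obtain ⟨D, hD₁, hD⟩ := exists_linearMap_apply_X_mul u v
  let δ : R[X] →ₗ[R] R[X] := - D ∘ₗ σ.symm.toLinearMap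
  have hσu : σ.symm u = X := by
    rw [AlgEquiv.symm_apply_eq]
    simp [σ]
  have hδ (f : R[X]) : δ (u * f) = X * δ f - v * f := by
    have hf : aeval u (σ.symm f) = f := σ.apply_symm_apply f
    simp [δ, hσu, hD, hf]
    ring
  let A : Module.End R (ℕ →₀ R[X]) :=
    Finsupp.lsum R fun j =>
      Finsupp.lsingle (j + 1) ∘ₗ σ.symm.toLinearMap + Finsupp.lsingle j ∘ₗ δ
  let B : Module.End R (ℕ →₀ R[X]) := Finsupp.mapRange.linearMap (LinearMap.mulLeft R X)
  have hA (j : ℕ) (f : R[X]) :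
      A (Finsupp.single j f) = Finsupp.single (j + 1) (σ.symm f) + Finsupp.single j (δ f) := by
    simp [A]
  have hB (j : ℕ) (f : R[X]) : B (Finsupp.single j f) = Finsupp.single j (X * f) := by
    simp [B]
  have hBpow (i j : ℕ) (f : R[X]) :
      (B ^ i) (Finsupp.single j f) = Finsupp.single j (X ^ i * f) := by
    induction i with
    | zero => simp
    | succ i ih => rw [pow_succ', Module.End.mul_apply, ih, hB, pow_succ', mul_assoc]
  have hBaeval (g f : R[X]) (j : ℕ) :
      aeval B g (Finsupp.single j f) = Finsupp.single j (g * f) := by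
    induction g using Polynomial.induction_on' with
    | add p q hp hq => rw [map_add, LinearMap.add_apply, hp, hq, add_mul, Finsupp.single_add]
    | monomial i r =>
      rw [← C_mul_X_pow_eq_monomial, ← smul_eq_C_mul, map_smul, map_pow, aeval_X,
        LinearMap.smul_apply, hBpow, Finsupp.smul_single, smul_mul_assoc]
  have hApow (j : ℕ) : (A ^ j) (Finsupp.single 0 1) = Finsupp.single j 1 := by
    induction j with
    | zero => simp
    | succ j ih =>
      rw [pow_succ', Module.End.mul_apply, ih, hA]
      simp [δ, hD₁]
  refine ⟨A, B, Finsupp.single 0 1, ?_, ?_⟩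
  · refine Finsupp.lhom_ext fun j f => ?_
    simp only [Module.End.mul_apply, LinearMap.add_apply, hA, hBaeval, map_add, hB, map_mul, hσu,
      hδ, Finsupp.single_sub]
    abel
  · have hli := (Finsupp.basis fun _ : ℕ => basisMonomials R).linearIndependent.comp
      (fun ij : ℕ × ℕ => (⟨ij.2, ij.1⟩ : Σ _ : ℕ, ℕ))
      (fun x y h => by simp only [Sigma.mk.injEq, heq_eq_eq] at h; exact Prod.ext h.2 h.1)
    convert hli using 2 with ij
    rw [Module.End.mul_apply, hApow, hBpow]
    simp [monomial_one_right_eq_X_pow]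

open Polynomial in
theorem linearIndependent_and_span_quotient_pow_mul_pow {R : Type*} [CommRing R] {c : R}
    (hc : IsNilpotent c) (v : R[X]) {g : FreeAlgebra R (Fin 2)}
    (hg : g = FreeAlgebra.ι R 1 * FreeAlgebra.ι R 0 -
      FreeAlgebra.ι R 0 * aeval (FreeAlgebra.ι R 1) (X + C c * v) -
      aeval (FreeAlgebra.ι R 1) v) :
    let I := TwoSidedIdeal.span {g}
    let b : ℕ × ℕ → I.ringCon.Quotient := fun ij =>
      RingCon.mk' I.ringCon (FreeAlgebra.ι R 1 ^ ij.1 * FreeAlgebra.ι R 0 ^ ij.2)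
    LinearIndependent R b ∧ Submodule.span R (Set.range b) = ⊤ := by
  intro I b
  have hbij := bijective_aeval_X_add_C_mul hc v
  set u := X + C c * v
  let π : FreeAlgebra R (Fin 2) →ₐ[R] I.ringCon.Quotient := RingCon.mkₐ R I.ringCon
  constructor
  · obtain ⟨A, B, m, hAB, hli⟩ := exists_end_linearIndependent_pow_mul_pow v hbij
    let φ : FreeAlgebra R (Fin 2) →ₐ[R] Module.End R (ℕ →₀ R[X]) := FreeAlgebra.lift R ![A, B]
    have hφ₀ : φ (FreeAlgebra.ι R 0) = A := by simp [φ]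
    have hφ₁ : φ (FreeAlgebra.ι R 1) = B := by simp [φ]
    have hφg : φ g = 0 := by
      rw [hg, map_sub, map_sub, map_mul, map_mul, ← aeval_algHom_apply, ← aeval_algHom_apply,
        hφ₀, hφ₁, hAB]
      abel
    have hI : I ≤ TwoSidedIdeal.ker φ :=
      TwoSidedIdeal.span_le.2 (by simpa [TwoSidedIdeal.mem_ker] using hφg)
    let ψ : I.ringCon.Quotient →ₐ[R] Module.End R (ℕ →₀ R[X]) :=
      RingCon.liftₐ I.ringCon φ fun x y hxy => by
        have h := (TwoSidedIdeal.mem_ker φ).1 (hI ((TwoSidedIdeal.rel_iff I x y).1 hxy))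
        rw [map_sub, sub_eq_zero] at h
        exact h
    refine LinearIndependent.of_comp (LinearMap.applyₗ m ∘ₗ ψ.toLinearMap) ?_
    convert hli using 2 with ij
    change φ (FreeAlgebra.ι R 1 ^ ij.1 * FreeAlgebra.ι R 0 ^ ij.2) m = _
    rw [map_mul, map_pow, map_pow, hφ₀, hφ₁]
  · have hπg : π g = 0 := by
      have h : I.ringCon g 0 := (TwoSidedIdeal.rel_iff I g 0).2
        (by rw [sub_zero]; exact TwoSidedIdeal.subset_span (Set.mem_singleton g))
      exact (RingCon.eq I.ringCon).2 h
    rw [hg, map_sub, map_sub, map_mul, map_mul, ← aeval_algHom_apply, ← aeval_algHom_apply,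
      sub_sub, sub_eq_zero] at hπg
    have hlift : FreeAlgebra.lift R ![π (FreeAlgebra.ι R 0), π (FreeAlgebra.ι R 1)] = π := by
      ext i
      fin_cases i <;> simp
    refine eq_top_iff.2 fun y _ => ?_
    obtain ⟨x, rfl⟩ := RingCon.mk'_surjective I.ringCon y
    have h := lift_mem_span_pow_mul_pow hbij.2 hπg x
    rw [hlift] at h
    exact h

theorem exists_one_add_mul_X_pow_eq {p k : ℕ} (hk : 1 ≤ k) (hdvd : p ∣ k - 1) :
    ∃ v : Polynomial ℤ, (1 + (p : Polynomial ℤ) * Polynomial.X) ^ k =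
      1 + (p : Polynomial ℤ) * (Polynomial.X + (p : Polynomial ℤ) * v) := by
  obtain ⟨m, hm⟩ := hdvd
  obtain ⟨q, hq⟩ := Polynomial.powAddExpansion 1 ((p : Polynomial ℤ) * Polynomial.X) k
  refine ⟨(m : Polynomial ℤ) * Polynomial.X + q * Polynomial.X ^ 2, ?_⟩
  have hk' : (k : Polynomial ℤ) = 1 + p * m := by
    exact_mod_cast show k = 1 + p * m by omega
  rw [hq, hk', one_pow, one_pow]
  ring


/-- With `p` prime, `n ≥ 1`, `k ≥ 2`, `p ∣ k - 1`, let
`h₀ ∈ FreeAlgebra ℤ (Fin 2)` be the (unique) element with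
`p² • h₀ = (1 + p X_1)(1 + p X_0) - (1 + p X_0)(1 + p X_1)^k`, let `g₀` be its image in
`FreeAlgebra (ZMod (p^n)) (Fin 2)` and `I(g₀)` the two-sided ideal it generates. Then the images
modulo `I(g₀)` of the monomials `X_1^i * X_0^j`, for `(i, j) ∈ ℕ × ℕ`, form a basis of the
quotient as a `ZMod (p^n)`-module. -/
theorem baumslag_solitar_algebra_basis_right
    (p n k : ℕ) (hp : Nat.Prime p) (hn : 1 ≤ n) (hk : 2 ≤ k) (hdvd : p ∣ k - 1)
    (h₀ : FreeAlgebra ℤ (Fin 2))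
    (hh₀ : ((p : ℤ) ^ 2) • h₀ =
      (1 + (p : FreeAlgebra ℤ (Fin 2)) * FreeAlgebra.ι ℤ 1) *
        (1 + (p : FreeAlgebra ℤ (Fin 2)) * FreeAlgebra.ι ℤ 0) -
      (1 + (p : FreeAlgebra ℤ (Fin 2)) * FreeAlgebra.ι ℤ 0) *
        (1 + (p : FreeAlgebra ℤ (Fin 2)) * FreeAlgebra.ι ℤ 1) ^ k)
    (g₀ : FreeAlgebra (ZMod (p ^ n)) (Fin 2))
    (hg₀ : g₀ = FreeAlgebra.lift ℤ (fun j => FreeAlgebra.ι (ZMod (p ^ n)) j) h₀) :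
    let I := TwoSidedIdeal.span {g₀}
    let b : ℕ × ℕ → I.ringCon.Quotient := fun ij =>
      RingCon.mk' I.ringCon
        (FreeAlgebra.ι (ZMod (p ^ n)) 1 ^ ij.1 * FreeAlgebra.ι (ZMod (p ^ n)) 0 ^ ij.2)
    LinearIndependent (ZMod (p ^ n)) b ∧
      Submodule.span (ZMod (p ^ n)) (Set.range b) = ⊤ := by
  obtain ⟨v, hv⟩ := exists_one_add_mul_X_pow_eq (by omega : 1 ≤ k) hdvd
  have hp0 : (p : ℤ) ^ 2 ≠ 0 := pow_ne_zero 2 (by exact_mod_cast hp.ne_zero)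
  have hh : h₀ = FreeAlgebra.ι ℤ 1 * FreeAlgebra.ι ℤ 0 -
      FreeAlgebra.ι ℤ 0 * (FreeAlgebra.ι ℤ 1 +
        (p : FreeAlgebra ℤ (Fin 2)) * Polynomial.aeval (FreeAlgebra.ι ℤ 1) v) -
      Polynomial.aeval (FreeAlgebra.ι ℤ 1) v := by
    have hv' := congrArg (Polynomial.aeval (FreeAlgebra.ι ℤ (1 : Fin 2))) hv
    simp only [map_pow, map_add, map_mul, map_one, map_natCast, Polynomial.aeval_X] at hv'
    rw [hv'] at hh₀
    refine smul_right_injective _ hp0 (hh₀.trans ?_)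
    have hp_smul (x : FreeAlgebra ℤ (Fin 2)) : (p : FreeAlgebra ℤ (Fin 2)) * x = (p : ℤ) • x := by
      rw [zsmul_eq_mul, Int.cast_natCast]
    simp only [hp_smul, mul_add, add_mul, mul_one, one_mul, smul_mul_assoc, mul_smul_comm]
    module

  refine linearIndependent_and_span_quotient_pow_mul_pow (c := (p : ZMod (p ^ n)))
    ⟨n, by rw [← Nat.cast_pow, ZMod.natCast_self]⟩ (v.map (Int.castRingHom (ZMod (p ^ n)))) ?_
  have haeval : FreeAlgebra.lift ℤ (fun j => FreeAlgebra.ι (ZMod (p ^ n)) j)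
      (Polynomial.aeval (FreeAlgebra.ι ℤ (1 : Fin 2)) v) =
      Polynomial.aeval (FreeAlgebra.ι (ZMod (p ^ n)) (1 : Fin 2))
        (v.map (Int.castRingHom (ZMod (p ^ n)))) := by
    rw [← Polynomial.aeval_algHom_apply, FreeAlgebra.lift_ι_apply]
    exact (Polynomial.aeval_map_algebraMap (ZMod (p ^ n)) _ v).symm
  rw [hg₀, hh]
  simp only [map_sub, map_add, map_mul, map_natCast, haeval, FreeAlgebra.lift_ι_apply,
    Polynomial.aeval_X]
end

section
/- With p, n, k and the relators g_0, g_1 as in the context, the images modulo the two-sided ideal I(g_0, g_1) of the elements X^w * X_1^j, where w ranges over all finite lists with entries in {0, 2} ⊆ Fin 3 and j ∈ ℕ, form a basis of the quotient FreeAlgebra (ZMod (p^n)) (Fin 3) ⧸ I(g_0, g_1) as a ZMod (p^n)-module. -/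
open Polynomial in
theorem exists_eq_neg_eval_add_mul {B : Type*} [CommRing B] {π : B} (hπ : IsNilpotent π)
    (q : B[X]) (c : B) : ∃ d : B, d = -q.eval (c + π * d) := by
  have approx (i : ℕ) : ∃ d : B, π ^ i ∣ d + q.eval (c + π * d) := by
    induction i with
    | zero => exact ⟨0, by simp⟩
    | succ i ih =>
      obtain ⟨d, e, he⟩ := ih
      refine ⟨-q.eval (c + π * d), ?_⟩
      rw [neg_add_eq_sub]
      refine dvd_trans ⟨-e, ?_⟩ (Polynomial.sub_dvd_eval_sub _ _ q)
      linear_combination (-π) * he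
  obtain ⟨N, hN⟩ := hπ
  obtain ⟨d, hd⟩ := approx N
  rw [hN, zero_dvd_iff] at hd
  exact ⟨d, eq_neg_of_add_eq_zero_left hd⟩

namespace FreeAlgebra

/-- A map `δ` such that `u ↦ u + π • δ u` is multiplicative is freely determined on generators. -/
theorem exists_twisted_derivation {R X : Type*} [CommRing R] (π : R)
    (d : X → FreeAlgebra R X) :
    ∃ δ : FreeAlgebra R X →ₗ[R] FreeAlgebra R X, (∀ i, δ (ι R i) = d i) ∧ δ 1 = 0 ∧
      ∀ u v, δ (u * v) = u * δ v + δ u * v + π • (δ u * δ v) := by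
  let Θ : FreeAlgebra R X →ₐ[R] Matrix (Fin 2) (Fin 2) (FreeAlgebra R X) :=
    lift R fun i => !![ι R i + π • d i, d i; 0, ι R i]
  have hΘ (u : FreeAlgebra R X) :
      Θ u 0 0 = u + π • Θ u 0 1 ∧ Θ u 1 0 = 0 ∧ Θ u 1 1 = u := by
    induction u with
    | grade0 r => simp [Matrix.algebraMap_matrix_apply]
    | grade1 i => simp [Θ]
    | mul u v hu hv =>
      obtain ⟨hu1, hu2, hu3⟩ := hu
      obtain ⟨hv1, hv2, hv3⟩ := hv
      simp only [map_mul, Matrix.mul_apply, Fin.sum_univ_two, hu1, hu2, hu3, hv1, hv2, hv3]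
      refine ⟨?_, by simp, by simp⟩
      simp only [mul_add, add_mul, smul_add, mul_smul_comm, smul_mul_assoc, mul_zero]
      abel
    | add u v hu hv =>
      obtain ⟨hu1, hu2, hu3⟩ := hu
      obtain ⟨hv1, hv2, hv3⟩ := hv
      simp only [map_add, Matrix.add_apply, hu1, hu2, hu3, hv1, hv2, hv3, smul_add]
      refine ⟨by abel, by simp, trivial⟩
  refine ⟨(Matrix.entryLinearMap R _ 0 1).comp Θ.toLinearMap, fun i => by simp [Θ], by simp,
    fun u v => ?_⟩
  simp only [LinearMap.comp_apply, AlgHom.toLinearMap_apply, Matrix.entryLinearMap_apply, map_mul,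
    Matrix.mul_apply, Fin.sum_univ_two, (hΘ u).1, (hΘ v).2.2]
  simp only [add_mul, smul_mul_assoc]
  abel

end FreeAlgebra

namespace Polynomial

section Module

variable {R F : Type*} [CommRing R] [Ring F] [Algebra R F]

theorem end_ext_X_pow {f g : Module.End F F[X]} (h : ∀ j : ℕ, f (X ^ j) = g (X ^ j)) : f = g :=
  (basisMonomials F).ext fun j => by simpa [monomial_one_right_eq_X_pow] using h j

theorem exists_end_X_pow_eq (v : ℕ → F[X]) :
    ∃ f : Module.End F F[X], ∀ j : ℕ, f (X ^ j) = v j :=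
  ⟨(basisMonomials F).constr ℕ v, fun j => by
    simpa [monomial_one_right_eq_X_pow] using (basisMonomials F).constr_basis ℕ v j⟩

theorem C_mul_X_pow_succ' (r : R) (n : ℕ) : C r * X ^ (n + 1) = X * (C r * X ^ n) := by
  rw [pow_succ]; ring

theorem aeval_end_apply_of_mul_X {Y : Module.End F F[X]} (hY : ∀ m, Y m = m * X) (q : R[X])
    (m : F[X]) : aeval Y q m = m * q.map (algebraMap R F) := by
  induction q using Polynomial.induction_on with
  | C r =>
    rw [aeval_C, Module.algebraMap_end_apply, map_C, ← Polynomial.algebraMap_apply,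
      ← Algebra.commutes, Algebra.smul_def]
  | add p q hp hq => simp [hp, hq, mul_add]
  | monomial n r h =>
    rw [C_mul_X_pow_succ', map_mul, aeval_X, Module.End.mul_apply, h, hY, Polynomial.map_mul (p := X),
      map_X, X_mul, mul_assoc]

theorem aeval_end_apply_one {T : Module.End F F[X]} {c : F} (hT : T 1 = C c) (q : R[X]) :
    aeval T q 1 = C (aeval c q) := by
  have hT' (u : F) : T (C u) = C (u * c) := by
    rw [← mul_one (C u), ← smul_eq_C_mul, map_smul, hT, smul_eq_C_mul, C_mul]
  induction q using Polynomial.induction_on with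
  | C r => simp [Module.algebraMap_end_apply, Algebra.smul_def, Polynomial.algebraMap_apply]
  | add p q hp hq => simp [hp, hq]
  | monomial n r h =>
    rw [C_mul_X_pow_succ', map_mul, aeval_X, Module.End.mul_apply, h, hT', X_mul, map_mul _ _ X,
      aeval_X]

theorem map_aeval_end_apply {T : Module.End F F[X]} {D : F[X] →ₗ[R] F[X]}
    (h : ∀ m, D (T m) = T (D m)) (q : R[X]) (m : F[X]) :
    D (aeval T q m) = aeval T q (D m) := by
  induction q using Polynomial.induction_on with
  | C r => simp [Module.algebraMap_end_apply]
  | add p q hp hq => simp [hp, hq]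
  | monomial n r ih =>
    rw [C_mul_X_pow_succ', map_mul, aeval_X, Module.End.mul_apply, h, ih, Module.End.mul_apply]

end Module

end Polynomial

namespace Polynomial

variable {R : Type*} [CommRing R]

/-- Right multiplication by a new letter `a` subject to `x a = a x + π a ψ(x) + ψ(x)`. -/
theorem exists_end_mul_X_comm {F : Type*} [Ring F] [Algebra R F] (π : R) (ψ : R[X]) (a : F)
    {Y : Module.End F F[X]} (hY : ∀ m, Y m = m * X) :
    ∃ A : Module.End F F[X], A 1 = C a ∧
      A * Y = Y * A + π • (aeval Y ψ * A) + aeval Y ψ := by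
  let v : ℕ → F[X] := fun j => Nat.rec (C a)
    (fun j m => m * X + π • (m * ψ.map (algebraMap R F)) + X ^ j * ψ.map (algebraMap R F)) j
  obtain ⟨A, hA⟩ := exists_end_X_pow_eq v
  refine ⟨A, by simpa [v] using hA 0, end_ext_X_pow fun j => ?_⟩
  simp only [Module.End.mul_apply, LinearMap.add_apply, LinearMap.smul_apply, hY, hA, ← pow_succ,
    aeval_end_apply_of_mul_X hY]
  rfl

/-- Right multiplication by a generator subject to `c x = x c + π x ψ(c) + ψ(c)`. -/
theorem exists_end_mul_X_comm' {S : Type*} {π : R} (hπ : IsNilpotent π) (ψ : R[X]) (i : S)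
    {Y : Module.End (FreeAlgebra R S) (FreeAlgebra R S)[X]} (hY : ∀ m, Y m = m * X) :
    ∃ T : Module.End (FreeAlgebra R S) (FreeAlgebra R S)[X], T 1 = C (FreeAlgebra.ι R i) ∧
      Y * T = T * Y + π • (aeval T ψ * Y) + aeval T ψ := by
  set F := FreeAlgebra R S
  set c : F := FreeAlgebra.ι R i with hc
  obtain ⟨d, hd⟩ : ∃ d : F, d = -aeval (c + π • d) ψ := by
    obtain ⟨d, hd⟩ := exists_eq_neg_eval_add_mul (hπ.map (C : R →+* R[X])) (ψ.map C) X
    refine ⟨aeval c d, ?_⟩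
    conv_lhs => rw [hd]
    rw [map_neg, eval_map, ← algebraMap_eq, ← aeval_def, ← aeval_algHom_apply]
    simp [Algebra.smul_def]
  classical
  obtain ⟨δ, hδι, hδ1, hδ⟩ := FreeAlgebra.exists_twisted_derivation π (Function.const S d)
  have hδψ (q : R[X]) : aeval (c + π • d) q = aeval c q + π • δ (aeval c q) := by
    induction q using Polynomial.induction_on with
    | C r => simp [Algebra.algebraMap_eq_smul_one, hδ1]
    | add p q hp hq => simp only [map_add, hp, hq, smul_add]; abel
    | monomial n r h =>
      rw [pow_succ, ← mul_assoc, map_mul, h, map_mul _ _ X, hδ, aeval_X, aeval_X, hc, hδι]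
      simp only [Function.const_apply, mul_add, add_mul, smul_add, mul_smul_comm, smul_mul_assoc]
      abel
  let D : F[X] →ₗ[R] F[X] := Polynomial.lsum fun j =>
    ((monomial (j + 1)).restrictScalars R).comp (LinearMap.id + π • δ) +
      ((monomial j).restrictScalars R).comp δ
  have hD (j : ℕ) (u : F) :
      D (monomial j u) = monomial (j + 1) (u + π • δ u) + monomial j (δ u) := by
    simp [D, Polynomial.lsum]
  have hDsmul (u : F) (m : F[X]) : D (u • m) = (u + π • δ u) • D m + δ u • m := by
    induction m using Polynomial.induction_on' with
    | add p q hp hq => simp only [smul_add, map_add, hp, hq]; abel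
    | monomial j v =>
      rw [smul_monomial, hD, hD, smul_add, smul_monomial, smul_monomial, smul_monomial, add_assoc,
        ← map_add]
      simp only [smul_eq_mul, hδ]
      congr 2 <;>
      simp only [mul_add, add_mul, smul_add, mul_smul_comm, smul_mul_assoc] <;> abel
  have hDX (j : ℕ) : D (X ^ j) = X ^ (j + 1) := by
    simp [← monomial_one_right_eq_X_pow, hD, hδ1]
  obtain ⟨T, hT⟩ := exists_end_X_pow_eq fun j => D^[j] (C c)
  have hT1 : T 1 = C c := by simpa using hT 0
  have hDT (m : F[X]) : D (T m) = T (D m) := by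
    induction m using Polynomial.induction_on' with
    | add p q hp hq => simp only [map_add, hp, hq]
    | monomial j u =>
      rw [← mul_one u, ← smul_eq_mul, ← smul_monomial, monomial_one_right_eq_X_pow, map_smul,
        hDsmul, hDsmul, map_add, map_smul, map_smul, hDX, hT, hT, Function.iterate_succ_apply']
  have hDY (m : F[X]) : D (Y m) = Y (D m) := by
    induction m using Polynomial.induction_on' with
    | add p q hp hq => simp only [map_add, hp, hq]
    | monomial j u => simp only [hY, monomial_mul_X, hD, add_mul]
  have hY1 : Y 1 = D 1 := by simpa [hY] using (hDX 0).symm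
  refine ⟨T, hT1, end_ext_X_pow fun j => ?_⟩
  induction j with
  | zero =>
    simp only [pow_zero, Module.End.mul_apply, LinearMap.add_apply, LinearMap.smul_apply, hY1,
      ← hDT, ← map_aeval_end_apply hDT, aeval_end_apply_one hT1, hT1, ← monomial_zero_left, hD]
    rw [hY, monomial_mul_X, hc, hδι, ← hc, Function.const_apply]
    obtain rfl : d = -(aeval c ψ + π • δ (aeval c ψ)) := hδψ ψ ▸ hd
    simp only [map_add, map_neg, smul_add, smul_neg, smul_monomial]
    abel
  | succ j ih =>
    rw [← hDX]
    simp only [Module.End.mul_apply, LinearMap.add_apply, LinearMap.smul_apply] at ih ⊢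
    rw [← hDT, ← hDY, ih, ← hDY, ← hDT, ← map_aeval_end_apply hDT, ← map_aeval_end_apply hDT,
      ← map_smul D, ← map_add, ← map_add]

end Polynomial

namespace AmalgamAlgebra

open Polynomial

variable {R : Type*} [CommRing R]

/-- The words in the outer letters `0` and `2`. -/
abbrev OuterWord : Type := {w : List (Fin 3) // ∀ i ∈ w, i = 0 ∨ i = 2}

/-- The normal form `X^w * X_1^j`. -/
def normalForm (R : Type*) [CommRing R] (wj : OuterWord × ℕ) : FreeAlgebra R (Fin 3) :=
  (wj.1.1.map (FreeAlgebra.ι R)).prod * FreeAlgebra.ι R 1 ^ wj.2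

/-- The relator `x a - a x - π a ψ(x) - ψ(x)` with `x = X_1`, `a = X_0`. -/
noncomputable def relatorLeft (π : R) (ψ : R[X]) : FreeAlgebra R (Fin 3) :=
  FreeAlgebra.ι R 1 * FreeAlgebra.ι R 0 - FreeAlgebra.ι R 0 * FreeAlgebra.ι R 1 -
    π • (FreeAlgebra.ι R 0 * aeval (FreeAlgebra.ι R 1) ψ) - aeval (FreeAlgebra.ι R 1) ψ

/-- The relator `c x - x c - π x ψ(c) - ψ(c)` with `x = X_1`, `c = X_2`. -/
noncomputable def relatorRight (π : R) (ψ : R[X]) : FreeAlgebra R (Fin 3) :=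
  FreeAlgebra.ι R 2 * FreeAlgebra.ι R 1 - FreeAlgebra.ι R 1 * FreeAlgebra.ι R 2 -
    π • (FreeAlgebra.ι R 1 * aeval (FreeAlgebra.ι R 2) ψ) - aeval (FreeAlgebra.ι R 2) ψ

theorem linearIndependent_smul_X_pow :
    LinearIndependent R fun wj : OuterWord × ℕ =>
      (wj.1.1.map (FreeAlgebra.ι R)).prod • (X ^ wj.2 : (FreeAlgebra R (Fin 3))[X]) := by
  have h := (((FreeAlgebra.basisFreeMonoid R (Fin 3)).smulTower
    (basisMonomials (FreeAlgebra R (Fin 3)))).linearIndependent).comp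
    (fun wj : OuterWord × ℕ => (FreeMonoid.ofList wj.1.1, wj.2)) (by
      rintro ⟨⟨w, hw⟩, j⟩ ⟨⟨w', hw'⟩, j'⟩ h
      simpa using h)
  convert! h using 2 with wj
  simp [FreeAlgebra.basisFreeMonoid, FreeAlgebra.equivMonoidAlgebraFreeMonoid,
    FreeMonoid.lift_ofList, monomial_one_right_eq_X_pow]

open MulOpposite in
theorem exists_representation {π : R} (hπ : IsNilpotent π) (ψ : R[X]) :
    ∃ Φ : FreeAlgebra R (Fin 3) →ₐ[R]
        (Module.End (FreeAlgebra R (Fin 3)) (FreeAlgebra R (Fin 3))[X])ᵐᵒᵖ,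
      Φ (relatorLeft π ψ) = 0 ∧ Φ (relatorRight π ψ) = 0 ∧
      ∀ wj : OuterWord × ℕ, (Φ (normalForm R wj)).unop 1 =
        (wj.1.1.map (FreeAlgebra.ι R)).prod • X ^ wj.2 := by
  set F := FreeAlgebra R (Fin 3)
  obtain ⟨Y, hYX⟩ := exists_end_X_pow_eq fun j => (X : F[X]) ^ (j + 1)
  have hY (m : F[X]) : Y m = m * X := by
    induction m using Polynomial.induction_on' with
    | add p q hp hq => simp only [map_add, hp, hq, add_mul]
    | monomial j u =>
      rw [← mul_one u, ← smul_eq_mul, ← smul_monomial, monomial_one_right_eq_X_pow, map_smul, hYX,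
        pow_succ, smul_mul_assoc]
  obtain ⟨A, hA1, hA⟩ := exists_end_mul_X_comm π ψ (FreeAlgebra.ι R (0 : Fin 3)) hY
  obtain ⟨T, hT1, hT⟩ := exists_end_mul_X_comm' hπ ψ (2 : Fin 3) hY
  let Φ : F →ₐ[R] (Module.End F F[X])ᵐᵒᵖ := FreeAlgebra.lift R ![op A, op Y, op T]
  have hΦ0 : Φ (FreeAlgebra.ι R 0) = op A := FreeAlgebra.lift_ι_apply _ _
  have hΦ1 : Φ (FreeAlgebra.ι R 1) = op Y := FreeAlgebra.lift_ι_apply _ _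
  have hΦ2 : Φ (FreeAlgebra.ι R 2) = op T := FreeAlgebra.lift_ι_apply _ _
  have hop (Z : Module.End F F[X]) (q : R[X]) : aeval (op Z) q = op (aeval Z q) := by
    induction q using Polynomial.induction_on with
    | C r => simp [MulOpposite.algebraMap_apply]
    | add p q hp hq => simp [hp, hq]
    | monomial n r h =>
      rw [C_mul_X_pow_succ', map_mul, h, X_mul, map_mul _ _ X, aeval_X, aeval_X, ← op_mul]
  refine ⟨Φ, ?_, ?_, ?_⟩
  · rw [relatorLeft]
    simp only [map_sub, map_mul, map_smul, ← aeval_algHom_apply, hΦ0, hΦ1, hop, ← op_mul,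
      ← op_smul, hA, op_add]
    abel
  · rw [relatorRight]
    simp only [map_sub, map_mul, map_smul, ← aeval_algHom_apply, hΦ2, hΦ1, hop, ← op_mul,
      ← op_smul, hT, op_add]
    abel
  · rintro ⟨⟨w, hw⟩, j⟩
    have hword : (Φ (w.map (FreeAlgebra.ι R)).prod).unop 1 =
        (w.map (FreeAlgebra.ι R)).prod • (1 : F[X]) := by
      induction w using List.reverseRecOn with
      | nil => simp
      | append_singleton w i ih =>
        have hi : (Φ (FreeAlgebra.ι R i)).unop 1 = FreeAlgebra.ι R i • (1 : F[X]) := by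
          rcases hw i (by simp) with rfl | rfl
          · rw [hΦ0, unop_op, hA1, smul_eq_C_mul, mul_one]
          · rw [hΦ2, unop_op, hT1, smul_eq_C_mul, mul_one]
        rw [List.map_append, List.prod_append, map_mul, unop_mul, Module.End.mul_apply,
          ih fun l hl => hw l (by simp [hl]), map_smul, List.map_singleton, List.prod_singleton,
          hi, smul_smul]
    rw [normalForm]
    simp only [map_mul, map_pow, hΦ1, unop_mul, unop_pow, unop_op, Module.End.mul_apply, hword]
    clear hword
    induction j with
    | zero => simp
    | succ j ih => rw [pow_succ', Module.End.mul_apply, ih, hY, smul_mul_assoc, pow_succ]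

theorem linearIndependent_mk_normalForm {π : R} (hπ : IsNilpotent π) (ψ : R[X]) :
    LinearIndependent R fun wj => RingCon.mk'
      (TwoSidedIdeal.span {relatorLeft π ψ, relatorRight π ψ}).ringCon (normalForm R wj) := by
  obtain ⟨Φ, hl, hr, hΦ⟩ := exists_representation hπ ψ
  have hker : TwoSidedIdeal.span {relatorLeft π ψ, relatorRight π ψ} ≤ TwoSidedIdeal.ker Φ := by
    rw [TwoSidedIdeal.span_le]
    rintro u (rfl | rfl)
    · exact (TwoSidedIdeal.mem_ker Φ).mpr hl
    · exact (TwoSidedIdeal.mem_ker Φ).mpr hr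
  let Ψ := RingCon.liftₐ (R := R) _ Φ fun u v h =>
    (RingCon.ker_apply _).mpr (by
      have := (TwoSidedIdeal.mem_ker Φ).mp (hker ((TwoSidedIdeal.rel_iff _ u v).mp h))
      rwa [map_sub, sub_eq_zero] at this)
  let ev : (Module.End (FreeAlgebra R (Fin 3)) (FreeAlgebra R (Fin 3))[X])ᵐᵒᵖ →ₗ[R]
      (FreeAlgebra R (Fin 3))[X] :=
    { toFun := fun f => f.unop 1
      map_add' := fun f g => rfl
      map_smul' := fun r f => rfl }
  refine LinearIndependent.of_comp (ev.comp Ψ.toLinearMap) ?_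
  convert! (linearIndependent_smul_X_pow (R := R)) using 2 with wj
  exact hΦ wj

section Span

variable {A : Type*} [Ring A] [Algebra R A]

theorem mul_aeval_mem {V : Submodule R A} {y : A} (h : ∀ s ∈ V, s * y ∈ V) (q : R[X]) {s : A}
    (hs : s ∈ V) : s * aeval y q ∈ V := by
  induction q using Polynomial.induction_on with
  | C r =>
    rw [aeval_C, ← Algebra.commutes, ← Algebra.smul_def]
    exact V.smul_mem r hs
  | add p q hp hq =>
    rw [map_add, mul_add]
    exact V.add_mem hp hq
  | monomial n r ih =>
    rw [pow_succ, ← mul_assoc, map_mul _ _ X, aeval_X, ← mul_assoc]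
    exact h _ ih

theorem eq_top_of_sup_range_lsmul_eq_top {π : R} (hπ : IsNilpotent π) {S : Submodule R A}
    (h : S ⊔ LinearMap.range (LinearMap.lsmul R A π) = ⊤) : S = ⊤ := by
  have approx (i : ℕ) (s : A) : ∃ r : A, s - π ^ i • r ∈ S := by
    induction i with
    | zero => exact ⟨s, by simp⟩
    | succ i ih =>
      obtain ⟨r, hr⟩ := ih
      obtain ⟨u, hu, _, ⟨v, rfl⟩, huv⟩ := Submodule.mem_sup.mp (h ▸ Submodule.mem_top : r ∈ _)
      refine ⟨v, ?_⟩
      have : s - π ^ (i + 1) • v = s - π ^ i • r + π ^ i • u := by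
        rw [← huv, pow_succ, mul_smul, smul_add, LinearMap.lsmul_apply]; abel
      rw [this]
      exact S.add_mem hr (S.smul_mem _ hu)
  obtain ⟨N, hN⟩ := hπ
  refine eq_top_iff.mpr fun s _ => ?_
  obtain ⟨r, hr⟩ := approx N s
  simpa [hN] using hr

/-- Normal forms whose exponent lies in `N`, modulo `π`. -/
def normalFormSpan (q : FreeAlgebra R (Fin 3) →ₐ[R] A) (π : R) (N : Set ℕ) : Submodule R A :=
  Submodule.span R ((fun wj => q (normalForm R wj)) '' (Prod.snd ⁻¹' N)) ⊔
    LinearMap.range (LinearMap.lsmul R A π)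

variable {q : FreeAlgebra R (Fin 3) →ₐ[R] A} {π : R} {N : Set ℕ}

theorem normalForm_mem {w : OuterWord} {j : ℕ} (hj : j ∈ N) :
    q (normalForm R (w, j)) ∈ normalFormSpan q π N :=
  Submodule.mem_sup_left (Submodule.subset_span ⟨(w, j), hj, rfl⟩)

theorem smul_mem_normalFormSpan (s : A) : π • s ∈ normalFormSpan q π N :=
  Submodule.mem_sup_right ⟨s, rfl⟩

theorem normalFormSpan_mono {N' : Set ℕ} (h : N ⊆ N') :
    normalFormSpan q π N ≤ normalFormSpan q π N' :=
  sup_le_sup_right (Submodule.span_mono (Set.image_mono (Set.preimage_mono h))) _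

theorem mul_mem_normalFormSpan {N' : Set ℕ} {y : A}
    (h : ∀ w, ∀ j ∈ N, q (normalForm R (w, j)) * y ∈ normalFormSpan q π N') {s : A}
    (hs : s ∈ normalFormSpan q π N) : s * y ∈ normalFormSpan q π N' := by
  have : normalFormSpan q π N ≤ (normalFormSpan q π N').comap (LinearMap.mulRight R y) := by
    refine sup_le (Submodule.span_le.mpr ?_) ?_
    · rintro _ ⟨⟨w, j⟩, hj, rfl⟩
      exact h w j hj
    · rintro _ ⟨r, rfl⟩
      simpa using smul_mem_normalFormSpan (r * y)
  exact this hs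

theorem normalForm_succ (w : OuterWord) (j : ℕ) :
    normalForm R (w, j + 1) = normalForm R (w, j) * FreeAlgebra.ι R 1 := by
  simp [normalForm, pow_succ, mul_assoc]

theorem normalForm_zero_mul_mem (w : OuterWord) {i : Fin 3} (hi : i = 0 ∨ i = 2)
    (hN : 0 ∈ N) :
    q (normalForm R (w, 0)) * q (FreeAlgebra.ι R i) ∈ normalFormSpan q π N := by
  have : normalForm R (w, 0) * FreeAlgebra.ι R i =
      normalForm R (⟨w.1 ++ [i], by
        intro l hl
        rcases List.mem_append.mp hl with hl | hl
        · exact w.2 l hl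
        · rwa [List.mem_singleton.mp hl]⟩, 0) := by
    simp [normalForm]
  rw [← map_mul, this]
  exact normalForm_mem hN

theorem mul_ι_one_mem {N' : Set ℕ} (hN : ∀ j ∈ N, j + 1 ∈ N') {s : A}
    (hs : s ∈ normalFormSpan q π N) :
    s * q (FreeAlgebra.ι R 1) ∈ normalFormSpan q π N' :=
  mul_mem_normalFormSpan (fun w j hj => by
    rw [← map_mul, ← normalForm_succ]
    exact normalForm_mem (hN j hj)) hs

theorem mul_ι_zero_mem {ψ : R[X]} (hq : q (relatorLeft π ψ) = 0) {s : A}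
    (hs : s ∈ normalFormSpan q π Set.univ) :
    s * q (FreeAlgebra.ι R 0) ∈ normalFormSpan q π Set.univ := by
  refine mul_mem_normalFormSpan (fun w j _ => ?_) hs
  induction j with
  | zero => exact normalForm_zero_mul_mem w (.inl rfl) trivial
  | succ j ih =>
    simp only [relatorLeft, map_sub, map_mul, map_smul, ← aeval_algHom_apply] at hq
    have hxa : q (FreeAlgebra.ι R 1) * q (FreeAlgebra.ι R 0) =
        q (FreeAlgebra.ι R 0) * q (FreeAlgebra.ι R 1) +
          π • (q (FreeAlgebra.ι R 0) * aeval (q (FreeAlgebra.ι R 1)) ψ) +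
          aeval (q (FreeAlgebra.ι R 1)) ψ := by
      rw [← sub_eq_zero, ← hq]; abel
    rw [normalForm_succ, map_mul, mul_assoc, hxa, mul_add, mul_add, mul_smul_comm, ← mul_assoc]
    exact add_mem (add_mem (mul_ι_one_mem (fun _ _ => Set.mem_univ _) (ih trivial))
      (smul_mem_normalFormSpan _)) (mul_aeval_mem (fun s => mul_ι_one_mem fun _ _ => Set.mem_univ _)
        ψ (normalForm_mem (Set.mem_univ j)))

theorem mul_ι_two_mem_Iic {ψ : R[X]} (hq : q (relatorRight π ψ) = 0) (j : ℕ) {s : A}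
    (hs : s ∈ normalFormSpan q π (Set.Iic j)) :
    s * q (FreeAlgebra.ι R 2) ∈ normalFormSpan q π (Set.Iic j) := by
  induction j generalizing s with
  | zero =>
    refine mul_mem_normalFormSpan (fun w j hj => ?_) hs
    obtain rfl : j = 0 := Nat.le_zero.mp hj
    exact normalForm_zero_mul_mem w (.inr rfl) hj
  | succ j ih =>
    refine mul_mem_normalFormSpan (fun w i hi => ?_) hs
    have hle : normalFormSpan q π (Set.Iic j) ≤ normalFormSpan q π (Set.Iic (j + 1)) :=
      normalFormSpan_mono (Set.Iic_subset_Iic.mpr j.le_succ)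
    rcases Nat.le_succ_iff.mp hi with hi | rfl
    · exact hle (ih (normalForm_mem hi))
    · simp only [relatorRight, map_sub, map_mul, map_smul, ← aeval_algHom_apply] at hq
      have hxc : q (FreeAlgebra.ι R 1) * q (FreeAlgebra.ι R 2) =
          q (FreeAlgebra.ι R 2) * q (FreeAlgebra.ι R 1) -
            π • (q (FreeAlgebra.ι R 1) * aeval (q (FreeAlgebra.ι R 2)) ψ) -
            aeval (q (FreeAlgebra.ι R 2)) ψ := by
        rw [← sub_eq_zero, ← neg_eq_zero, ← hq]; abel
      have hw : q (normalForm R (w, j)) ∈ normalFormSpan q π (Set.Iic j) :=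
        normalForm_mem Set.self_mem_Iic
      rw [normalForm_succ, map_mul, mul_assoc, hxc, mul_sub, mul_sub, mul_smul_comm, ← mul_assoc]
      have hj (i : ℕ) (hi : i ∈ Set.Iic j) : i + 1 ∈ Set.Iic (j + 1) := by simpa using hi
      exact sub_mem (sub_mem (mul_ι_one_mem hj (ih hw))
        (smul_mem_normalFormSpan _)) (hle (mul_aeval_mem (fun s => ih) ψ hw))

theorem mul_ι_two_mem {ψ : R[X]} (hq : q (relatorRight π ψ) = 0) {s : A}
    (hs : s ∈ normalFormSpan q π Set.univ) :
    s * q (FreeAlgebra.ι R 2) ∈ normalFormSpan q π Set.univ :=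
  mul_mem_normalFormSpan (fun _ j _ => normalFormSpan_mono (Set.subset_univ _)
    (mul_ι_two_mem_Iic hq j (normalForm_mem Set.self_mem_Iic))) hs

theorem span_normalForm_eq_top (hπ : IsNilpotent π) {ψ : R[X]} (hsurj : Function.Surjective q)
    (hl : q (relatorLeft π ψ) = 0) (hr : q (relatorRight π ψ) = 0) :
    Submodule.span R (Set.range fun wj => q (normalForm R wj)) = ⊤ := by
  refine eq_top_of_sup_range_lsmul_eq_top hπ (eq_top_iff.mpr fun a _ => ?_)
  suffices h : a ∈ normalFormSpan q π Set.univ by simpa [normalFormSpan] using h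
  have hmul (u : FreeAlgebra R (Fin 3)) :
      ∀ s ∈ normalFormSpan q π Set.univ, s * q u ∈ normalFormSpan q π Set.univ := by
    induction u with
    | grade0 r =>
      intro s hs
      rw [AlgHom.commutes, ← Algebra.commutes, ← Algebra.smul_def]
      exact Submodule.smul_mem _ r hs
    | grade1 i =>
      intro s hs
      fin_cases i
      · exact mul_ι_zero_mem hl hs
      · exact mul_ι_one_mem (fun _ _ => Set.mem_univ _) hs
      · exact mul_ι_two_mem hr hs
    | mul u v hu hv =>
      intro s hs
      rw [map_mul, ← mul_assoc]
      exact hv _ (hu _ hs)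
    | add u v hu hv =>
      intro s hs
      rw [map_add, mul_add]
      exact add_mem (hu _ hs) (hv _ hs)
  obtain ⟨u, rfl⟩ := hsurj a
  have h1 : (1 : A) ∈ normalFormSpan q π Set.univ := by
    simpa [normalForm] using
      normalForm_mem (q := q) (π := π) (w := ⟨[], by simp⟩) (Set.mem_univ (0 : ℕ))
  simpa using hmul u 1 h1

end Span

theorem span_mk_normalForm_eq_top {π : R} (hπ : IsNilpotent π) (ψ : R[X]) :
    Submodule.span R (Set.range fun wj => RingCon.mk'
      (TwoSidedIdeal.span {relatorLeft π ψ, relatorRight π ψ}).ringCon (normalForm R wj)) = ⊤ := by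
  have hmk {u} (hu : u ∈ ({relatorLeft π ψ, relatorRight π ψ} : Set (FreeAlgebra R (Fin 3)))) :
      RingCon.mkₐ R (TwoSidedIdeal.span {relatorLeft π ψ, relatorRight π ψ}).ringCon u = 0 :=
    (RingCon.eq _).mpr (TwoSidedIdeal.subset_span hu)
  exact span_normalForm_eq_top
    (q := RingCon.mkₐ R (TwoSidedIdeal.span {relatorLeft π ψ, relatorRight π ψ}).ringCon) hπ
    (RingCon.mk'_surjective _) (hmk (.inl rfl)) (hmk (.inr rfl))

theorem exists_one_add_mul_X_pow {p k : ℕ} (hk : 1 ≤ k) (hdvd : p ∣ k - 1) :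
    ∃ ψ : ℤ[X], (1 + (p : ℤ[X]) * X) ^ k = 1 + (p : ℤ[X]) * X + (p : ℤ[X]) ^ 2 * ψ := by
  obtain ⟨l, hl⟩ := hdvd
  obtain ⟨q, hq⟩ := powAddExpansion 1 ((p : ℤ[X]) * X) k
  refine ⟨(l : ℤ[X]) * X + q * X ^ 2, ?_⟩
  have hk' : (k : ℤ[X]) = 1 + p * l := by exact_mod_cast (by omega : k = 1 + p * l)
  rw [hq, hk']
  ring

theorem relator_unique {p k : ℕ} (hp : p ≠ 0) {ψ : ℤ[X]}
    (hψ : (1 + (p : ℤ[X]) * X) ^ k = 1 + (p : ℤ[X]) * X + (p : ℤ[X]) ^ 2 * ψ)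
    {A : Type*} [Ring A] [IsDomain A] [CharZero A] {h y z : A}
    (hh : ((p : ℤ) ^ 2) • h = (1 + (p : A) * y) * (1 + (p : A) * z) -
      (1 + (p : A) * z) * (1 + (p : A) * y) ^ k) :
    h = y * z - z * y - (p : ℤ) • (z * aeval y ψ) - aeval y ψ := by
  have hy : (1 + (p : A) * y) ^ k = 1 + (p : A) * y + (p : A) ^ 2 * aeval y ψ := by
    simpa using congrArg (aeval y) hψ
  have hp2 : ((p : A) ^ 2) ≠ 0 := pow_ne_zero 2 (Nat.cast_ne_zero.mpr hp)
  refine mul_left_cancel₀ hp2 ?_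
  rw [hy] at hh
  simp only [zsmul_eq_mul, Int.cast_pow, Int.cast_natCast] at hh ⊢
  rw [hh]
  have e (u v : A) : u * ((p : A) * v) = p * (u * v) := by
    rw [← mul_assoc, ← (Nat.cast_commute p u).eq, mul_assoc]
  simp only [mul_add, add_mul, mul_sub, mul_one, one_mul, pow_two, mul_assoc, e]
  abel

theorem map_aeval_int {A B G : Type*} [Ring A] [Ring B] [Algebra R B] [FunLike G A B]
    [RingHomClass G A B] (f : G) (y : A) (ψ : ℤ[X]) :
    f (aeval y ψ) = aeval (f y) (ψ.map (Int.castRingHom R)) := by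
  rw [← algebraMap_int_eq, aeval_map_algebraMap]
  exact (aeval_algHom_apply (f : A →+* B).toIntAlgHom y ψ).symm

end AmalgamAlgebra

/-- With `p` prime, `n ≥ 1`, `k ≥ 2`, `p ∣ k - 1`, in
`FreeAlgebra ℤ (Fin 3)` let `h₀, h₁` be the (unique) elements with
`p² • h₀ = (1 + p X_1)(1 + p X_0) - (1 + p X_0)(1 + p X_1)^k` and
`p² • h₁ = (1 + p X_2)(1 + p X_1) - (1 + p X_1)(1 + p X_2)^k`, let `g₀, g₁` be their images in
`FreeAlgebra (ZMod (p^n)) (Fin 3)` and `I(g₀, g₁)` the two-sided ideal they generate. Then the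
images modulo `I(g₀, g₁)` of the elements `X^w * X_1^j`, for `w` a list over `{0, 2} ⊆ Fin 3` and
`j ∈ ℕ`, form a basis of the quotient as a `ZMod (p^n)`-module. -/
theorem amalgam_algebra_basis
    (p n k : ℕ) (hp : Nat.Prime p) (hn : 1 ≤ n) (hk : 2 ≤ k) (hdvd : p ∣ k - 1)
    (h₀ h₁ : FreeAlgebra ℤ (Fin 3))
    (hh₀ : ((p : ℤ) ^ 2) • h₀ =
      (1 + (p : FreeAlgebra ℤ (Fin 3)) * FreeAlgebra.ι ℤ 1) *
        (1 + (p : FreeAlgebra ℤ (Fin 3)) * FreeAlgebra.ι ℤ 0) -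
      (1 + (p : FreeAlgebra ℤ (Fin 3)) * FreeAlgebra.ι ℤ 0) *
        (1 + (p : FreeAlgebra ℤ (Fin 3)) * FreeAlgebra.ι ℤ 1) ^ k)
    (hh₁ : ((p : ℤ) ^ 2) • h₁ =
      (1 + (p : FreeAlgebra ℤ (Fin 3)) * FreeAlgebra.ι ℤ 2) *
        (1 + (p : FreeAlgebra ℤ (Fin 3)) * FreeAlgebra.ι ℤ 1) -
      (1 + (p : FreeAlgebra ℤ (Fin 3)) * FreeAlgebra.ι ℤ 1) *
        (1 + (p : FreeAlgebra ℤ (Fin 3)) * FreeAlgebra.ι ℤ 2) ^ k)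
    (g₀ g₁ : FreeAlgebra (ZMod (p ^ n)) (Fin 3))
    (hg₀ : g₀ = FreeAlgebra.lift ℤ (fun j => FreeAlgebra.ι (ZMod (p ^ n)) j) h₀)
    (hg₁ : g₁ = FreeAlgebra.lift ℤ (fun j => FreeAlgebra.ι (ZMod (p ^ n)) j) h₁) :
    let I := TwoSidedIdeal.span {g₀, g₁}
    let b : {w : List (Fin 3) // ∀ i ∈ w, i = 0 ∨ i = 2} × ℕ → I.ringCon.Quotient := fun wj =>
      RingCon.mk' I.ringCon
        (((wj.1 : List (Fin 3)).map (FreeAlgebra.ι (ZMod (p ^ n)))).prod *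
          FreeAlgebra.ι (ZMod (p ^ n)) 1 ^ wj.2)
    LinearIndependent (ZMod (p ^ n)) b ∧
      Submodule.span (ZMod (p ^ n)) (Set.range b) = ⊤ := by
  obtain ⟨ψ, hψ⟩ := AmalgamAlgebra.exists_one_add_mul_X_pow (by omega : 1 ≤ k) hdvd
  have hπ : IsNilpotent (p : ZMod (p ^ n)) := ⟨n, by exact_mod_cast ZMod.natCast_self (p ^ n)⟩
  have : CharZero (FreeAlgebra ℤ (Fin 3)) :=
    charZero_of_injective_algebraMap (R := ℤ) FreeAlgebra.algebraMap_leftInverse.injective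
  rw [AmalgamAlgebra.relator_unique hp.ne_zero hψ hh₀] at hg₀
  rw [AmalgamAlgebra.relator_unique hp.ne_zero hψ hh₁] at hg₁
  replace hg₀ : g₀ = AmalgamAlgebra.relatorLeft (p : ZMod (p ^ n)) (ψ.map (Int.castRingHom _)) := by
    simp [hg₀, AmalgamAlgebra.relatorLeft, AmalgamAlgebra.map_aeval_int (R := ZMod (p ^ n)),
      Algebra.smul_def]
  replace hg₁ : g₁ =
      AmalgamAlgebra.relatorRight (p : ZMod (p ^ n)) (ψ.map (Int.castRingHom _)) := by
    simp [hg₁, AmalgamAlgebra.relatorRight, AmalgamAlgebra.map_aeval_int (R := ZMod (p ^ n)),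
      Algebra.smul_def]
  subst hg₀ hg₁
  exact ⟨AmalgamAlgebra.linearIndependent_mk_normalForm hπ _,
    AmalgamAlgebra.span_mk_normalForm_eq_top hπ _⟩
end

section
/- Let p be a prime and k ≥ 2 an integer with p ∣ k − 1. Let H(k) be the Higman group with generators a_0, a_1, a_2, a_3, and let B ≤ H(k) be the subgroup generated by a_0 and a_1 (a copy of the Baumslag–Solitar group BS(1,k)). Then for every g ∈ B with g ≠ 1 there exist a finite group Q which is a p-group (IsPGroup p Q) and a group homomorphism φ : H(k) →* Q such that φ g ≠ 1. -/
/-- The relators of the Higman group `H(k)`: for each `i : Fin 4` (indices mod 4),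
the relator `(a_{i+1} a_i) (a_i a_{i+1}^k)⁻¹`, expressing `a_i⁻¹ a_{i+1} a_i = a_{i+1}^k`. -/
def higmanRels (k : ℕ) : Set (FreeGroup (Fin 4)) :=
  ⋃ i : Fin 4,
    {(FreeGroup.of (i + 1) * FreeGroup.of i) * (FreeGroup.of i * FreeGroup.of (i + 1) ^ k)⁻¹}

/-- The Higman group `H(k)`. -/
abbrev HigmanGroup (k : ℕ) : Type := PresentedGroup (higmanRels k)

namespace HigmanGroup

open Finsupp

/-- The free module on words in two letters. -/
abbrev WordModule (p : ℕ) : Type := List Bool →₀ ZMod p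

/-- The submodule spanned by the words of length at least `d`. -/
def lengthFiltration (p d : ℕ) : Submodule (ZMod p) (WordModule p) :=
  supported (ZMod p) (ZMod p) {l | d ≤ l.length}

/-- The submodule spanned by the words in which `c` occurs at most `n` times. -/
def countFiltration (p : ℕ) (c : Bool) (n : ℕ) : Submodule (ZMod p) (WordModule p) :=
  supported (ZMod p) (ZMod p) {l | l.count c ≤ n}

/-- The operators that increase the length of words by at least `j`. -/
def raising (p j : ℕ) : Submodule (ZMod p) (Module.End (ZMod p) (WordModule p)) where
  carrier := {f | ∀ d, ∀ v ∈ lengthFiltration p d, f v ∈ lengthFiltration p (d + j)}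
  add_mem' hf hg d v hv := add_mem (hf d v hv) (hg d v hv)
  zero_mem' _ _ _ := zero_mem _
  smul_mem' c _ hf d v hv := Submodule.smul_mem _ c (hf d v hv)

/-- Prefixing a letter. -/
noncomputable def consMap (p : ℕ) (b : Bool) : Module.End (ZMod p) (WordModule p) :=
  lmapDomain (ZMod p) (ZMod p) (List.cons b)

/-- The unipotent operator `1 + consMap b`. -/
noncomputable def shear (p : ℕ) (b : Bool) : Module.End (ZMod p) (WordModule p) :=
  1 + consMap p b

variable {p : ℕ}

@[simp]
lemma consMap_single (b : Bool) (l : List Bool) (x : ZMod p) :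
    consMap p b (single l x) = single (b :: l) x := by
  simp [consMap]

lemma shear_sub_one (b : Bool) : shear p b - 1 = consMap p b :=
  add_sub_cancel_left (G := Module.End (ZMod p) (WordModule p)) 1 _

lemma lengthFiltration_anti {d e : ℕ} (h : d ≤ e) :
    lengthFiltration p e ≤ lengthFiltration p d :=
  supported_mono fun _ hl => h.trans hl

lemma countFiltration_mono (c : Bool) {m n : ℕ} (h : m ≤ n) :
    countFiltration p c m ≤ countFiltration p c n :=
  supported_mono fun _ hl => le_trans hl h

lemma single_mem_lengthFiltration {d : ℕ} {l : List Bool} (h : d ≤ l.length) :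
    single l 1 ∈ lengthFiltration p d :=
  single_mem_supported _ _ h

lemma single_mem_countFiltration {c : Bool} {n : ℕ} {l : List Bool} (h : l.count c ≤ n) :
    single l 1 ∈ countFiltration p c n :=
  single_mem_supported _ _ h

lemma countFiltration_le_iff {c : Bool} {n : ℕ} {N : Submodule (ZMod p) (WordModule p)} :
    countFiltration p c n ≤ N ↔ ∀ l : List Bool, l.count c ≤ n → single l 1 ∈ N := by
  rw [countFiltration, supported_eq_span_single, Submodule.span_le]
  exact Set.forall_mem_image

lemma mem_raising_iff {j : ℕ} {f : Module.End (ZMod p) (WordModule p)} :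
    f ∈ raising p j ↔ ∀ l : List Bool, f (single l 1) ∈ lengthFiltration p (l.length + j) := by
  refine ⟨fun h l => h _ _ (single_mem_lengthFiltration le_rfl), fun h d => ?_⟩
  change lengthFiltration p d ≤ (lengthFiltration p (d + j)).comap f
  rw [lengthFiltration, supported_eq_span_single, Submodule.span_le]
  rintro _ ⟨l, hl, rfl⟩
  exact lengthFiltration_anti (Nat.add_le_add_right hl j) (h l)

lemma raising_anti {i j : ℕ} (h : i ≤ j) : raising p j ≤ raising p i :=
  fun _ hf d v hv => lengthFiltration_anti (Nat.add_le_add_left h d) (hf d v hv)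

lemma mul_mem_raising {i j : ℕ} {f g : Module.End (ZMod p) (WordModule p)}
    (hf : f ∈ raising p i) (hg : g ∈ raising p j) : f * g ∈ raising p (i + j) := by
  intro d v hv
  have := hf _ _ (hg d v hv)
  rwa [add_assoc, add_comm j i] at this

lemma one_mem_raising : (1 : Module.End (ZMod p) (WordModule p)) ∈ raising p 0 :=
  fun _ _ hv => hv

lemma pow_mem_raising {f : Module.End (ZMod p) (WordModule p)} (hf : f ∈ raising p 1) (n : ℕ) :
    f ^ n ∈ raising p n := by
  induction n with
  | zero => simpa using one_mem_raising
  | succ n ih => rw [pow_succ]; exact mul_mem_raising ih hf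

/-- The operators that are congruent to the identity modulo operators raising the length. -/
def unipotent (p : ℕ) : Submonoid (Module.End (ZMod p) (WordModule p)) where
  carrier := {f | f - 1 ∈ raising p 1}
  one_mem' := by
    change (1 : Module.End (ZMod p) (WordModule p)) - 1 ∈ raising p 1
    convert zero_mem (raising p 1) using 1
    exact sub_self (G := Module.End (ZMod p) (WordModule p)) 1
  mul_mem' {f g} hf hg := by
    have h : f * g - 1 = (f - 1) * (g - 1) + (f - 1) + (g - 1) := by
      ext1 l
      ext1
      simp only [LinearMap.comp_apply, LinearMap.sub_apply, LinearMap.add_apply,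
        Module.End.mul_apply, Module.End.one_apply, map_sub]
      abel
    change f * g - 1 ∈ raising p 1
    rw [h]
    exact add_mem (add_mem (raising_anti (by norm_num) (mul_mem_raising hf hg)) hf) hg

lemma mem_raising_zero_of_mem_unipotent {f : Module.End (ZMod p) (WordModule p)}
    (hf : f ∈ unipotent p) : f ∈ raising p 0 := by
  have h := add_mem (raising_anti (Nat.zero_le 1) hf) one_mem_raising
  exact (sub_add_cancel (G := Module.End (ZMod p) (WordModule p)) f 1) ▸ h

lemma consMap_mem_raising (b : Bool) : consMap p b ∈ raising p 1 :=
  mem_raising_iff.2 fun l => by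
    rw [consMap_single]; exact single_mem_lengthFiltration (by simp)

lemma shear_mem_unipotent (b : Bool) : shear p b ∈ unipotent p := by
  change shear p b - 1 ∈ raising p 1
  rw [shear_sub_one]
  exact consMap_mem_raising b

lemma pow_prime_pow_sub_one [Fact p.Prime] (f : Module.End (ZMod p) (WordModule p)) (n : ℕ) :
    f ^ p ^ n - 1 = (f - 1) ^ p ^ n := by
  have : CharP (Module.End (ZMod p) (WordModule p)) p :=
    charP_of_injective_algebraMap
      (FaithfulSMul.algebraMap_injective (ZMod p) (Module.End (ZMod p) (WordModule p))) p
  have h := sub_pow_char_pow_of_commute (R := Module.End (ZMod p) (WordModule p)) (x := f)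
    (y := 1) p n (Commute.one_right f)
  rw [one_pow] at h
  exact h.symm

lemma pow_prime_pow_mul_sub_one_mem_raising [Fact p.Prime]
    {f : Module.End (ZMod p) (WordModule p)} (hf : f ∈ unipotent p) (n m : ℕ) :
    f ^ (p ^ n * m) - 1 ∈ raising p (p ^ n) := by
  rw [mul_comm, pow_mul, pow_prime_pow_sub_one]
  exact pow_mem_raising (pow_mem hf m) _

lemma pow_sub_self_mem_raising [Fact p.Prime] {f : Module.End (ZMod p) (WordModule p)}
    (hf : f ∈ unipotent p) {k : ℕ} (hk : 1 ≤ k) (hdvd : p ∣ k - 1) : f ^ k - f ∈ raising p 2 := by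
  obtain ⟨m, hm⟩ := hdvd
  obtain rfl : k = p * m + 1 := by omega
  have h := pow_prime_pow_mul_sub_one_mem_raising hf 1 m
  rw [pow_one] at h
  have h2 := mul_mem_raising (raising_anti (Fact.out : p.Prime).two_le h)
    (mem_raising_zero_of_mem_unipotent hf)
  have h3 : (f ^ (p * m) - 1) * f = f ^ (p * m + 1) - f := by
    rw [pow_succ]
    exact sub_one_mul (f ^ (p * m)) f
  rwa [h3] at h2

/-- The values on words of the next approximation, given the approximation `u`, to the operator
`twist` below. -/
noncomputable def twistStep (k r : ℕ) (c : Bool) (u : Module.End (ZMod p) (WordModule p)) :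
    List Bool → WordModule p
  | [] => single [] 1
  | b :: w =>
    if b = c then (shear p c * u ^ k - u) (single w 1)
    else (shear p (!c) ^ r - 1) (twistStep k r c u w)

/-- Successive approximations of the operator `twist` below. -/
noncomputable def twistApprox (p k r : ℕ) (c : Bool) : ℕ → Module.End (ZMod p) (WordModule p)
  | 0 => 1
  | n + 1 => linearCombination (ZMod p) (twistStep k r c (twistApprox p k r c n))

/-- The operator `U` fixing the empty word with `U * shear c = shear c * U ^ k` and
`U * shear (!c) = shear (!c) ^ r * U`. -/
noncomputable def twist (p k r : ℕ) (c : Bool) : Module.End (ZMod p) (WordModule p) :=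
  linearCombination (ZMod p) fun l => twistApprox p k r c (l.count c + 1) (single l 1)

variable {k r : ℕ} {c : Bool}

lemma twistApprox_succ_nil (n : ℕ) :
    twistApprox p k r c (n + 1) (single [] 1) = single [] 1 := by
  simp [twistApprox, twistStep]

lemma twistApprox_succ_cons_self (n : ℕ) (w : List Bool) :
    twistApprox p k r c (n + 1) (single (c :: w) 1) =
      (shear p c * twistApprox p k r c n ^ k - twistApprox p k r c n) (single w 1) := by
  simp [twistApprox, twistStep]

lemma twistApprox_succ_cons_not (n : ℕ) (w : List Bool) :
    twistApprox p k r c (n + 1) (single ((!c) :: w) 1) =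
      (shear p (!c) ^ r - 1) (twistApprox p k r c (n + 1) (single w 1)) := by
  simp [twistApprox, twistStep]

lemma eq_or_eq_not (b c : Bool) : b = c ∨ b = !c := by
  cases b <;> cases c <;> simp

lemma shear_mem_countFiltration {n : ℕ} {v : WordModule p} (hv : v ∈ countFiltration p c n) :
    shear p c v ∈ countFiltration p c (n + 1) := by
  revert v
  change countFiltration p c n ≤ (countFiltration p c (n + 1)).comap (shear p c)
  refine countFiltration_le_iff.2 fun l hl => ?_
  simp only [Submodule.mem_comap, shear, LinearMap.add_apply, Module.End.one_apply,
    consMap_single]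
  exact add_mem (single_mem_countFiltration (by omega))
    (single_mem_countFiltration (by simpa using hl))

lemma shear_not_mem_countFiltration {n : ℕ} {v : WordModule p}
    (hv : v ∈ countFiltration p c n) : shear p (!c) v ∈ countFiltration p c n := by
  revert v
  change countFiltration p c n ≤ (countFiltration p c n).comap (shear p (!c))
  refine countFiltration_le_iff.2 fun l hl => ?_
  simp only [Submodule.mem_comap, shear, LinearMap.add_apply, Module.End.one_apply,
    consMap_single]
  exact add_mem (single_mem_countFiltration hl)
    (single_mem_countFiltration (by simpa [List.count_cons] using hl))

lemma pow_apply_mem {N : Submodule (ZMod p) (WordModule p)}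
    {f : Module.End (ZMod p) (WordModule p)} (hf : ∀ v ∈ N, f v ∈ N) (m : ℕ) :
    ∀ v ∈ N, (f ^ m) v ∈ N := by
  induction m with
  | zero => intro v hv; simpa using hv
  | succ m ih => intro v hv; rw [pow_succ]; exact ih _ (hf v hv)

lemma pow_apply_eq_of_eqOn {N : Submodule (ZMod p) (WordModule p)}
    {f g : Module.End (ZMod p) (WordModule p)} (hf : ∀ v ∈ N, f v ∈ N)
    (hfg : ∀ v ∈ N, f v = g v) (m : ℕ) : ∀ v ∈ N, (f ^ m) v = (g ^ m) v := by
  induction m with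
  | zero => intro v _; simp
  | succ m ih =>
    intro v hv
    rw [pow_succ, pow_succ, Module.End.mul_apply, Module.End.mul_apply, ih _ (hf v hv), hfg v hv]

lemma twistApprox_mem_countFiltration (n : ℕ) :
    ∀ j, ∀ v ∈ countFiltration p c j, twistApprox p k r c n v ∈ countFiltration p c j := by
  induction n with
  | zero => intro j v hv; simpa [twistApprox] using hv
  | succ n ih =>
    intro j
    change countFiltration p c j ≤ (countFiltration p c j).comap (twistApprox p k r c (n + 1))
    refine countFiltration_le_iff.2 fun l hl => ?_
    rw [Submodule.mem_comap]
    induction l with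
    | nil => rw [twistApprox_succ_nil]; exact single_mem_countFiltration hl
    | cons b w ihw =>
      rcases eq_or_eq_not b c with rfl | rfl
      · rw [List.count_cons_self] at hl
        obtain ⟨i, rfl⟩ : ∃ i, j = i + 1 := ⟨j - 1, by omega⟩
        have hw : single w 1 ∈ countFiltration p b i := single_mem_countFiltration (by omega)
        rw [twistApprox_succ_cons_self, LinearMap.sub_apply, Module.End.mul_apply]
        exact sub_mem (shear_mem_countFiltration (pow_apply_mem (ih i) k _ hw))
          (countFiltration_mono b i.le_succ (ih i _ hw))
      · have hw := ihw (by simpa [List.count_cons] using hl)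
        rw [twistApprox_succ_cons_not, LinearMap.sub_apply, Module.End.one_apply]
        exact sub_mem (pow_apply_mem (fun v hv => shear_not_mem_countFiltration hv) r _ hw) hw

lemma twistApprox_succ_succ_apply (n : ℕ) : ∀ v ∈ countFiltration p c n,
    twistApprox p k r c (n + 2) v = twistApprox p k r c (n + 1) v := by
  induction n with
  | zero =>
    change countFiltration p c 0 ≤ LinearMap.eqLocus _ _
    refine countFiltration_le_iff.2 fun l hl => ?_
    rw [LinearMap.mem_eqLocus]
    induction l with
    | nil => simp only [twistApprox_succ_nil]
    | cons b w ihw =>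
      rcases eq_or_eq_not b c with rfl | rfl
      · simp at hl
      · rw [twistApprox_succ_cons_not, twistApprox_succ_cons_not,
          ihw (by simpa [List.count_cons] using hl)]
  | succ n ih =>
    change countFiltration p c (n + 1) ≤ LinearMap.eqLocus _ _
    refine countFiltration_le_iff.2 fun l hl => ?_
    rw [LinearMap.mem_eqLocus]
    induction l with
    | nil => simp only [twistApprox_succ_nil]
    | cons b w ihw =>
      rcases eq_or_eq_not b c with rfl | rfl
      · have hw : single w 1 ∈ countFiltration p b n :=
          single_mem_countFiltration (by simpa using hl)
        rw [twistApprox_succ_cons_self, twistApprox_succ_cons_self, LinearMap.sub_apply,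
          LinearMap.sub_apply, Module.End.mul_apply, Module.End.mul_apply, ih _ hw,
          pow_apply_eq_of_eqOn (twistApprox_mem_countFiltration (n + 2) n) ih k _ hw]
      · rw [twistApprox_succ_cons_not, twistApprox_succ_cons_not,
          ihw (by simpa [List.count_cons] using hl)]

lemma twistApprox_apply_of_le {m n : ℕ} (h : m ≤ n) : ∀ v ∈ countFiltration p c m,
    twistApprox p k r c (n + 1) v = twistApprox p k r c (m + 1) v := by
  induction n, h using Nat.le_induction with
  | base => intro v _; rfl
  | succ n hmn ih =>
    intro v hv
    rw [twistApprox_succ_succ_apply n v (countFiltration_mono c hmn hv), ih v hv]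

lemma twist_apply (n : ℕ) : ∀ v ∈ countFiltration p c n,
    twist p k r c v = twistApprox p k r c (n + 1) v := by
  change countFiltration p c n ≤ LinearMap.eqLocus _ _
  refine countFiltration_le_iff.2 fun l hl => ?_
  rw [LinearMap.mem_eqLocus, twist, linearCombination_single, one_smul,
    twistApprox_apply_of_le hl _ (single_mem_countFiltration le_rfl)]

lemma twistApprox_mem_unipotent [Fact p.Prime] (hk : 1 ≤ k) (hkp : p ∣ k - 1) (hr : 1 ≤ r)
    (hrp : p ∣ r - 1) (n : ℕ) : twistApprox p k r c n ∈ unipotent p := by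
  induction n with
  | zero => exact one_mem _
  | succ n ih =>
    refine mem_raising_iff.2 fun l => ?_
    rw [LinearMap.sub_apply, Module.End.one_apply]
    induction l with
    | nil => rw [twistApprox_succ_nil, sub_self]; exact zero_mem _
    | cons b w ihw =>
      have hw : single w 1 ∈ lengthFiltration p w.length := single_mem_lengthFiltration le_rfl
      rcases eq_or_eq_not b c with rfl | rfl
      · have h : (shear p b * twistApprox p k r b n ^ k - twistApprox p k r b n) -
            consMap p b = consMap p b * (twistApprox p k r b n ^ k - 1) +
              (twistApprox p k r b n ^ k - twistApprox p k r b n) := by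
          ext1 l
          ext1
          simp only [shear, LinearMap.comp_apply, LinearMap.sub_apply, LinearMap.add_apply,
            Module.End.mul_apply, Module.End.one_apply, map_sub]
          abel
        rw [twistApprox_succ_cons_self, ← consMap_single, ← LinearMap.sub_apply, h]
        have hU : twistApprox p k r b n ^ k - 1 ∈ raising p 1 := pow_mem ih k
        have h1 := mul_mem_raising (consMap_mem_raising b) hU
        have h2 := add_mem h1 (pow_sub_self_mem_raising ih hk hkp)
        exact h2 _ _ hw
      · rw [twistApprox_succ_cons_not]
        have hX : shear p (!c) ^ r - 1 ∈ raising p 1 := pow_mem (shear_mem_unipotent (!c)) r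
        have h1 := hX _ _ ihw
        have h2 := pow_sub_self_mem_raising (shear_mem_unipotent (!c)) hr hrp _ _ hw
        have h3 := add_mem h1 h2
        have h4 (v : WordModule p) :
            (shear p (!c) ^ r - 1) v - single ((!c) :: w) 1 =
              (shear p (!c) ^ r - 1) (v - single w 1) +
                (shear p (!c) ^ r - shear p (!c)) (single w 1) := by
          have h5 : shear p (!c) (single w 1) = single w 1 + single ((!c) :: w) 1 := by
            rw [shear, LinearMap.add_apply, consMap_single, Module.End.one_apply]
          rw [map_sub, LinearMap.sub_apply, LinearMap.sub_apply, LinearMap.sub_apply,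
            Module.End.one_apply, Module.End.one_apply, h5]
          abel
        rw [h4]
        exact h3

lemma twist_mem_unipotent [Fact p.Prime] (hk : 1 ≤ k) (hkp : p ∣ k - 1) (hr : 1 ≤ r)
    (hrp : p ∣ r - 1) : twist p k r c ∈ unipotent p := by
  refine mem_raising_iff.2 fun l => ?_
  rw [LinearMap.sub_apply, twist_apply _ _ (single_mem_countFiltration le_rfl),
    ← LinearMap.sub_apply]
  exact mem_raising_iff.1 (twistApprox_mem_unipotent hk hkp hr hrp _) l

lemma twist_mul_shear_self : twist p k r c * shear p c = shear p c * twist p k r c ^ k := by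
  refine lhom_ext' fun l => LinearMap.ext_ring ?_
  have hl : single l 1 ∈ countFiltration p c (l.count c) := single_mem_countFiltration le_rfl
  have hinv := twistApprox_mem_countFiltration (p := p) (k := k) (r := r) (c := c)
    (l.count c + 1) (l.count c)
  have hpow := pow_apply_eq_of_eqOn hinv (fun v hv => (twist_apply _ v hv).symm) k _ hl
  have hcons : twist p k r c (single (c :: l) 1) =
      (shear p c * twistApprox p k r c (l.count c + 1) ^ k -
        twistApprox p k r c (l.count c + 1)) (single l 1) := by
    rw [← twistApprox_succ_cons_self]
    exact twist_apply _ _ (single_mem_countFiltration (by simp))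
  rw [LinearMap.comp_apply, LinearMap.comp_apply, lsingle_apply, Module.End.mul_apply,
    Module.End.mul_apply, ← hpow]
  nth_rw 1 [shear]
  rw [LinearMap.add_apply, map_add, Module.End.one_apply, consMap_single, hcons,
    twist_apply _ _ hl, LinearMap.sub_apply, Module.End.mul_apply]
  abel

lemma twist_mul_shear_not :
    twist p k r c * shear p (!c) = shear p (!c) ^ r * twist p k r c := by
  refine lhom_ext' fun l => LinearMap.ext_ring ?_
  have hl : single l 1 ∈ countFiltration p c (l.count c) := single_mem_countFiltration le_rfl
  have hcons : twist p k r c (single ((!c) :: l) 1) =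
      (shear p (!c) ^ r - 1) (twist p k r c (single l 1)) := by
    rw [twist_apply _ _ hl, ← twistApprox_succ_cons_not]
    exact twist_apply _ _ (single_mem_countFiltration (by simp))
  rw [LinearMap.comp_apply, LinearMap.comp_apply, lsingle_apply, Module.End.mul_apply,
    Module.End.mul_apply]
  nth_rw 1 [shear]
  rw [LinearMap.add_apply, map_add, Module.End.one_apply, consMap_single, hcons,
    LinearMap.sub_apply, Module.End.one_apply, add_sub_cancel]

lemma twist_mul_shear_not_pow (m : ℕ) :
    twist p k r c * shear p (!c) ^ m = shear p (!c) ^ (r * m) * twist p k r c := by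
  rw [pow_mul]
  exact SemiconjBy.pow_right twist_mul_shear_not m

/-- The action of unipotent operators on words of length less than `d`. -/
noncomputable def truncate (p d : ℕ) :
    unipotent p →* Module.End (ZMod p) (WordModule p ⧸ lengthFiltration p d) where
  toFun f := Submodule.mapQ _ _ f.1 fun v hv => mem_raising_zero_of_mem_unipotent f.2 d v hv
  map_one' := Submodule.mapQ_id _
  map_mul' f g := Submodule.mapQ_comp _ _ _ g.1 f.1
    (mem_raising_zero_of_mem_unipotent g.2 d) (mem_raising_zero_of_mem_unipotent f.2 d)

lemma truncate_eq_iff {d : ℕ} {f g : unipotent p} :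
    truncate p d f = truncate p d g ↔ ∀ v, (f.1 - g.1) v ∈ lengthFiltration p d := by
  constructor
  · intro h v
    have := LinearMap.congr_fun h (Submodule.Quotient.mk v)
    exact (Submodule.Quotient.eq _).1 this
  · intro h
    refine Submodule.linearMap_qext _ (LinearMap.ext fun v => ?_)
    exact (Submodule.Quotient.eq _).2 (h v)

lemma truncate_eq_of_sub_mem_raising {d : ℕ} {f g : unipotent p}
    (h : f.1 - g.1 ∈ raising p d) : truncate p d f = truncate p d g :=
  truncate_eq_iff.2 fun v => by
    have := h 0 v (by simp [lengthFiltration])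
    rwa [zero_add] at this

lemma truncate_pow_prime_pow [Fact p.Prime] (d : ℕ) (f : unipotent p) :
    truncate p d f ^ p ^ d = 1 := by
  rw [← map_pow, ← map_one (truncate p d)]
  refine truncate_eq_of_sub_mem_raising ?_
  have h := pow_prime_pow_mul_sub_one_mem_raising f.2 d 1
  rw [mul_one] at h
  exact raising_anti (Nat.lt_pow_self (Fact.out : p.Prime).one_lt).le h

lemma finite_quotient_lengthFiltration [Fact p.Prime] (d : ℕ) :
    Finite (WordModule p ⧸ lengthFiltration p d) := by
  have : Finite {l : List Bool // l.length < d} := (List.finite_length_lt Bool d).to_subtype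
  let π : WordModule p →ₗ[ZMod p] ({l : List Bool // l.length < d} → ZMod p) :=
    LinearMap.pi fun l => lapply l.1
  have hker : LinearMap.ker π = lengthFiltration p d := by
    ext v
    simp only [LinearMap.mem_ker, lengthFiltration, mem_supported', Set.mem_ofPred_eq, not_le]
    exact ⟨fun h l hl => congr_fun h ⟨l, hl⟩, fun h => funext fun l => h l.1 l.2⟩
  rw [← hker]
  exact Finite.of_injective _ π.quotKerEquivRange.injective

/-- The group of unipotent operators on words of length less than `d`. -/
abbrev TruncatedGroup (p d : ℕ) : Type := MonoidHom.mrange (truncate p d)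

lemma TruncatedGroup.pow_eq_one [Fact p.Prime] {d : ℕ} (g : TruncatedGroup p d) :
    g ^ p ^ d = 1 := by
  obtain ⟨_, f, rfl⟩ := g
  exact Subtype.ext (truncate_pow_prime_pow d f)

noncomputable instance [Fact p.Prime] (d : ℕ) : Group (TruncatedGroup p d) :=
  { (inferInstance : Monoid (TruncatedGroup p d)) with
    inv := fun g => g ^ (p ^ d - 1)
    inv_mul_cancel := fun g => by
      change g ^ (p ^ d - 1) * g = 1
      rw [← pow_succ, Nat.sub_add_cancel (Nat.one_le_pow _ _ (Fact.out : p.Prime).pos)]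
      exact TruncatedGroup.pow_eq_one g }

/-- A homomorphism from the Higman group given by elements satisfying the relations. -/
def lift {G : Type*} [Group G] (x : Fin 4 → G)
    (hx : ∀ i, x (i + 1) * x i = x i * x (i + 1) ^ k) : HigmanGroup k →* G :=
  PresentedGroup.toGroup (f := x) <| by
    intro s hs
    obtain ⟨i, rfl⟩ := Set.mem_iUnion.1 hs
    simp [hx i]

lemma of_mul_of (i : Fin 4) :
    (PresentedGroup.of (i + 1) * PresentedGroup.of i : HigmanGroup k) =
      PresentedGroup.of i * PresentedGroup.of (i + 1) ^ k := by
  rw [← mul_inv_eq_one]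
  exact PresentedGroup.one_of_mem (rels := higmanRels k) (Set.mem_iUnion.2 ⟨i, rfl⟩)

/-- The Higman group has finite `p`-quotients in which a given generator has large order. -/
theorem exists_generator_pow_ne_one (hp : p.Prime) (hk : 1 ≤ k) (hdvd : p ∣ k - 1) (j : Fin 4)
    (t : ℕ) : ∃ (Q : Type) (_ : Group Q) (_ : Finite Q), IsPGroup p Q ∧
      ∃ φ : HigmanGroup k →* Q, φ (PresentedGroup.of j) ^ p ^ t ≠ 1 := by
  have : Fact p.Prime := ⟨hp⟩
  set d := p ^ t + 1 with hd
  have : Finite (WordModule p ⧸ lengthFiltration p d) := finite_quotient_lengthFiltration d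
  have : Finite (Module.End (ZMod p) (WordModule p ⧸ lengthFiltration p d)) :=
    Finite.of_injective _ DFunLike.coe_injective
  set r := k ^ (p ^ d - 1) with hr
  have hr1 : 1 ≤ r := Nat.one_le_pow _ _ hk
  have hrp : p ∣ r - 1 := by
    refine hdvd.trans ?_
    simpa using Nat.sub_dvd_pow_sub_pow k 1 (p ^ d - 1)
  obtain ⟨s, hs⟩ : ∃ s, r * k = p ^ d * s + 1 := by
    have h1 : (p : ℤ) ∣ (k : ℤ) - 1 := by
      have := Int.natCast_dvd_natCast.2 hdvd
      rwa [Nat.cast_sub hk, Nat.cast_one] at this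
    have h2 := (pow_dvd_pow (p : ℤ) d.le_succ).trans (dvd_sub_pow_of_dvd_sub h1 d)
    have h3 : r * k = k ^ p ^ d := by
      rw [hr, ← pow_succ, Nat.sub_add_cancel (Nat.one_le_pow _ _ hp.pos)]
    have h4 : p ^ d ∣ k ^ p ^ d - 1 := by
      rw [← Int.natCast_dvd_natCast, Nat.cast_sub (Nat.one_le_pow _ _ hk)]
      simpa using h2
    obtain ⟨s, hs⟩ := h4
    exact ⟨s, by rw [h3, ← hs, Nat.sub_add_cancel (Nat.one_le_pow _ _ hk)]⟩
  let X (b : Bool) : unipotent p := ⟨shear p b, shear_mem_unipotent b⟩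
  let U (b : Bool) : unipotent p := ⟨twist p k r b, twist_mem_unipotent hk hdvd hr1 hrp⟩
  let τ := (truncate p d).mrangeRestrict
  have hXU (b : Bool) : τ (U b) * τ (X b) = τ (X b) * τ (U b) ^ k := by
    rw [← map_pow, ← map_mul, ← map_mul]
    exact congrArg τ (Subtype.ext twist_mul_shear_self)
  have hUX (b : Bool) : τ (X (!b)) * τ (U b) = τ (U b) * τ (X (!b)) ^ k := by
    have h : U b * X (!b) ^ k = X (!b) ^ (r * k) * U b :=
      Subtype.ext (twist_mul_shear_not_pow k)
    have h1 : τ (X (!b)) ^ (p ^ d * s) = 1 := by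
      rw [pow_mul, TruncatedGroup.pow_eq_one, one_pow]
    rw [← map_pow, ← map_mul _ (U b), h, map_mul, map_pow, hs, pow_succ, h1, one_mul]
  let x : Fin 4 → TruncatedGroup p d := ![τ (X false), τ (U false), τ (X true), τ (U true)]
  have hx (i : Fin 4) : x (i + 1) * x i = x i * x (i + 1) ^ k := by
    fin_cases i
    · exact hXU false
    · exact hUX false
    · exact hXU true
    · exact hUX true
  refine ⟨TruncatedGroup p d, inferInstance, inferInstance,
    fun g => ⟨d, TruncatedGroup.pow_eq_one g⟩, lift (fun i => x (i - j)) (fun i => ?_),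
    fun h => ?_⟩
  · rw [add_sub_right_comm]; exact hx _
  · rw [lift, PresentedGroup.toGroup.of, sub_self] at h
    have h1 : truncate p d (X false ^ p ^ t) = truncate p d 1 := by
      rw [map_pow, map_one]; exact congrArg Subtype.val h
    have h2 := truncate_eq_iff.1 h1 (single [] 1)
    have h3 (n : ℕ) : (consMap p false ^ n) (single [] 1) =
        single (List.replicate n false) 1 := by
      induction n with
      | zero => simp
      | succ n ih => rw [pow_succ', Module.End.mul_apply, ih, consMap_single, List.replicate_succ]
    have h4 : (X false ^ p ^ t : unipotent p).1 - (1 : unipotent p).1 =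
        consMap p false ^ p ^ t := by
      change shear p false ^ p ^ t - 1 = _
      rw [pow_prime_pow_sub_one, shear_sub_one]
    rw [h4, h3, lengthFiltration, mem_supported'] at h2
    have h5 := h2 (List.replicate (p ^ t) false) (by simp [hd])
    simp at h5

lemma eq_zero_of_generator_zpow_eq_one (hp : p.Prime) (hk : 1 ≤ k) (hdvd : p ∣ k - 1) (j : Fin 4)
    (z : ℤ) (h : ∀ (Q : Type) (_ : Group Q) (_ : Finite Q), IsPGroup p Q →
      ∀ φ : HigmanGroup k →* Q, φ (PresentedGroup.of j) ^ z = 1) : z = 0 := by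
  by_contra hz
  obtain ⟨Q, _, _, hQ, φ, hφ⟩ := exists_generator_pow_ne_one hp hk hdvd j z.natAbs
  have : Fact p.Prime := ⟨hp⟩
  obtain ⟨e, he⟩ := IsPGroup.iff_orderOf.1 hQ (φ (PresentedGroup.of j))
  have h1 : p ^ e ∣ z.natAbs := by
    rw [← he, ← Int.natCast_dvd]
    exact orderOf_dvd_iff_zpow_eq_one.2 (h Q _ ‹_› hQ φ)
  have h2 : e ≤ z.natAbs :=
    (Nat.lt_pow_self hp.one_lt).le.trans (Nat.le_of_dvd (Int.natAbs_pos.2 hz) h1)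
  exact hφ (orderOf_dvd_iff_pow_eq_one.1 (he ▸ pow_dvd_pow p h2))

lemma zpow_mul_of_mul_eq {G : Type*} [Group G] {a b : G} (h : b * a = a * b ^ k) (n : ℤ) :
    b ^ n * a = a * b ^ (k * n) := by
  have h' : SemiconjBy a (b ^ k) b := h.symm
  rw [zpow_mul, zpow_natCast]
  exact (h'.zpow_right n).symm

/-- Normal form in a quotient of the Baumslag–Solitar group `BS(1, k)`. -/
lemma exists_eq_pow_mul_zpow_mul_pow_inv {G : Type*} [Group G] {a b : G}
    (h : b * a = a * b ^ k) {g : G} (hg : g ∈ Subgroup.closure {a, b}) :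
    ∃ (m l : ℕ) (n : ℤ), g = a ^ m * b ^ n * (a ^ l)⁻¹ := by
  have hpow (m : ℕ) (n : ℤ) : b ^ n * a ^ m = a ^ m * b ^ ((k : ℤ) ^ m * n) := by
    induction m generalizing n with
    | zero => simp
    | succ m ih =>
      rw [pow_succ', ← mul_assoc, zpow_mul_of_mul_eq h, mul_assoc, ih, mul_assoc, pow_succ,
        mul_assoc]
  have hb (e : ℤ) (m l : ℕ) (n : ℤ) : b ^ e * (a ^ m * b ^ n * (a ^ l)⁻¹) =
      a ^ m * b ^ ((k : ℤ) ^ m * e + n) * (a ^ l)⁻¹ := by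
    rw [← mul_assoc, ← mul_assoc, hpow, mul_assoc (a ^ m), ← zpow_add]
  induction hg using Subgroup.closure_induction_left with
  | one => exact ⟨0, 0, 0, by simp⟩
  | mul_left x hx y _ ih =>
    obtain ⟨m, l, n, rfl⟩ := ih
    rcases hx with rfl | rfl
    · exact ⟨m + 1, l, n, by rw [pow_succ']; group⟩
    · exact ⟨m, l, _, by rw [← hb 1 m l n, zpow_one]⟩
  | inv_mul_cancel x hx y _ ih =>
    obtain ⟨m, l, n, rfl⟩ := ih
    rcases hx with rfl | rfl
    · cases m with
      | zero =>
        refine ⟨0, l + 1, k * n, ?_⟩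
        rw [pow_zero, one_mul, one_mul, pow_succ, mul_inv_rev, ← mul_assoc, ← mul_assoc]
        congr 1
        rw [inv_mul_eq_iff_eq_mul, ← mul_assoc, ← zpow_mul_of_mul_eq h, mul_inv_cancel_right]
      | succ m => exact ⟨m, l, n, by rw [pow_succ']; group⟩
    · exact ⟨m, l, _, by rw [← hb (-1) m l n, zpow_neg_one]⟩

end HigmanGroup

/-- Let `p` be a prime and `k ≥ 2` with `p ∣ k - 1`. Let `B ≤ H(k)` be the
subgroup generated by `a₀` and `a₁` (a copy of `BS(1,k)`). Then every nontrivial element of `B`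
survives in some finite `p`-quotient of `H(k)`. -/
theorem higman_baumslag_solitar_residually_p
    (p k : ℕ) (hp : Nat.Prime p) (hk : 2 ≤ k) (hdvd : p ∣ k - 1)
    (g : HigmanGroup k)
    (hg : g ∈ Subgroup.closure {PresentedGroup.of (0 : Fin 4), PresentedGroup.of (1 : Fin 4)})
    (hg1 : g ≠ 1) :
    ∃ (Q : Type) (_ : Group Q) (_ : Finite Q),
      IsPGroup p Q ∧ ∃ φ : HigmanGroup k →* Q, φ g ≠ 1 := by
  by_contra! hcon
  have hk1 : 1 ≤ k := by omega
  have hrel : (PresentedGroup.of 1 * PresentedGroup.of 0 : HigmanGroup k) =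
      PresentedGroup.of 0 * PresentedGroup.of 1 ^ k := HigmanGroup.of_mul_of 0
  obtain ⟨m, l, n, rfl⟩ := HigmanGroup.exists_eq_pow_mul_zpow_mul_pow_inv hrel hg
  have hφ (Q : Type) (_ : Group Q) (_ : Finite Q) (hQ : IsPGroup p Q) (φ : HigmanGroup k →* Q) :
      φ (PresentedGroup.of 0) ^ ((m : ℤ) - l) * φ (PresentedGroup.of 1) ^ n = 1 := by
    have h := hcon Q _ ‹_› hQ φ
    rw [map_mul, map_mul, map_inv, map_pow, map_pow, map_zpow, mul_inv_eq_one] at h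
    rw [sub_eq_neg_add, zpow_add, zpow_neg, zpow_natCast, zpow_natCast, mul_assoc, h,
      inv_mul_cancel]
  have hn : n = 0 := by
    have h0 : ((k : ℤ) - 1) * n = 0 := by
      refine HigmanGroup.eq_zero_of_generator_zpow_eq_one hp hk1 hdvd 1 _
        fun Q _ hfin hQ φ => ?_
      have h1 := eq_inv_of_mul_eq_one_right (hφ Q _ hfin hQ φ)
      have h2 : φ (PresentedGroup.of 1) * φ (PresentedGroup.of 0) =
          φ (PresentedGroup.of 0) * φ (PresentedGroup.of 1) ^ k := by
        simpa using congrArg φ hrel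
      have h3 := HigmanGroup.zpow_mul_of_mul_eq h2 n
      have h4 : Commute (φ (PresentedGroup.of 1) ^ n) (φ (PresentedGroup.of 0)) := by
        rw [h1]
        exact ((Commute.refl _).zpow_left _).inv_left
      rw [h4.eq, mul_right_inj] at h3
      rw [sub_mul, one_mul, zpow_sub, ← h3, mul_inv_cancel]
    rcases mul_eq_zero.1 h0 with h | h
    · omega
    · exact h
  subst hn
  have hml : (m : ℤ) - l = 0 :=
    HigmanGroup.eq_zero_of_generator_zpow_eq_one hp hk1 hdvd 0 _
      fun Q _ hfin hQ φ => by simpa using hφ Q _ hfin hQ φ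
  obtain rfl : m = l := by omega
  exact hg1 (by simp)
end
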